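/- arXiv:1609.03128 — 2 statements merged into one kernel-verified Lean document; each statement's English description precedes it below -/
import Mathlib

section
/- Let n ≥ 2, let (π,v) ∈ Vert(D_n), and let a, b ∈ {v(1),…,v(n)}. Then (π,v) has a rise labelled (a,b) if and only if (ζ_D(π), d_D(π,v)) has a valley labelled (b,a) or a valley labelled (−a,−b). Moreover, (π,v) has a rise labelled (±|a|, b) if and only if (ζ_D(π), d_D(π,v)) has a valley labelled (b, ±|a|). -/
inductive Step
  | N : Step
  | E : Step
  deriving DecidableEq

/-- The number of East steps strictly preceding the `k`-th North step. -/
def ebn : List Step → ℕ → ℕ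
  | _, 0 => 0
  | [], _ + 1 => 0
  | Step.E :: rest, k + 1 => ebn rest (k + 1) + 1
  | Step.N :: rest, k + 1 => ebn rest k

/-- A lattice path with `a` East steps and `b` North steps. -/
def IsLatticePath (a b : ℕ) (π : List Step) : Prop :=
  π.count Step.E = a ∧ π.count Step.N = b

/-- A ballot path of length `m`: every prefix has at least as many `N`s as `E`s. -/
def IsBallotPath (m : ℕ) (β : List Step) : Prop :=
  β.length = m ∧ ∀ k : ℕ, (β.take k).count Step.E ≤ (β.take k).count Step.N

/-- `i` is a rise: the `i`-th North step is immediately followed by a North step. -/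
def IsRise (π : List Step) (i : ℕ) : Prop :=
  ∃ p : ℕ, π[p]? = some Step.N ∧ π[p + 1]? = some Step.N ∧ (π.take p).count Step.N + 1 = i

/-- `(i,j)` is a valley: the `i`-th East step is immediately followed by the `j`-th North
step; in addition if the path ends with an East step and consists of `i` East steps and
`j - 1` North steps, then `(i, j)` counts as a valley. -/
def IsValley (β : List Step) (i j : ℕ) : Prop :=
  (∃ p : ℕ, β[p]? = some Step.E ∧ β[p + 1]? = some Step.N ∧
      (β.take p).count Step.E + 1 = i ∧ (β.take (p + 1)).count Step.N + 1 = j) ∨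
  (β.getLast? = some Step.E ∧ i = β.count Step.E ∧ j = β.count Step.N + 1)

/-- Read `a` from left to right, writing `N` for each entry `j` and `E` for each entry `j+1`. -/
def sPlusL (j : ℤ) (a : List ℤ) : List Step :=
  a.filterMap fun x => if x = j then some Step.N else if x = j + 1 then some Step.E else none

/-- Read `a` from right to left, writing `N` for each entry `j` and `E` for each entry `j+1`. -/
def sPlusR (j : ℤ) (a : List ℤ) : List Step := sPlusL j a.reverse

/-- Read `a` from left to right, writing `N` for each entry `-j` and `E` for each entry `-j-1`. -/
def sMinusL (j : ℤ) (a : List ℤ) : List Step :=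
  a.filterMap fun x => if x = -j then some Step.N else if x = -j - 1 then some Step.E else none

/-- Read `a` from right to left, writing `N` for each entry `-j` and `E` for each entry `-j-1`. -/
def sMinusR (j : ℤ) (a : List ℤ) : List Step := sMinusL j a.reverse

/-- `w` is the window `[w(1),…,w(n)]` of a signed permutation of rank `n`. -/
def IsSignedPerm (n : ℕ) (w : Fin n → ℤ) : Prop :=
  (∀ i, 1 ≤ |w i| ∧ |w i| ≤ (n : ℤ)) ∧ Function.Injective fun i => |w i|

/-- Evaluation of (the window of) a signed permutation at any integer, via `w(-j) = -w(j)`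
and `w(0) = 0`. -/
def evalSP {n : ℕ} (w : Fin n → ℤ) (j : ℤ) : ℤ :=
  if h : 1 ≤ j ∧ j ≤ (n : ℤ) then w ⟨(j - 1).toNat, by omega⟩
  else if h' : 1 ≤ -j ∧ -j ≤ (n : ℤ) then -w ⟨(-j - 1).toNat, by omega⟩
  else 0

/-- A possibly signed path: a path together with a sign `ε ∈ {1, -1}` carried by the
distinguished signed East step (the sign is `1` whenever there is no signed step). -/
structure SPath where
  path : List Step
  sgn : ℤ

/-- The `k`-th North step is immediately followed by an East step. -/
def NthNFollowedByE (β : List Step) (k : ℕ) : Prop :=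
  ∃ p : ℕ, β[p]? = some Step.N ∧ (β.take p).count Step.N + 1 = k ∧ β[p + 1]? = some Step.E

/-- Signed lattice paths `L•_{n-1,n}`: the first step may carry a sign if it is an East step. -/
def IsSignedLatticePath (n : ℕ) (π : SPath) : Prop :=
  IsLatticePath (n - 1) n π.path ∧ (π.sgn = 1 ∨ π.sgn = -1) ∧
    (π.path.head? = some Step.N → π.sgn = 1)

/-- Signed ballot paths `B•_{2n-1}`: the East step following the `n`-th North step (if any)
may carry a sign. -/
def IsSignedBallotPath (n : ℕ) (β : SPath) : Prop :=
  IsBallotPath (2 * n - 1) β.path ∧ (β.sgn = 1 ∨ β.sgn = -1) ∧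
    (¬ NthNFollowedByE β.path n → β.sgn = 1)

/-- The vector `λ(π)` of a signed lattice path (1-based index). -/
def lamD (n : ℕ) (π : SPath) (i : ℕ) : ℤ :=
  if i = 1 then π.sgn * (ebn π.path 1 : ℤ)
  else if i = n then
    (if (∑ k ∈ Finset.Icc 1 (n - 2), ebn π.path k) % 2 = 0 then
        2 * (ebn π.path n : ℤ) - (ebn π.path (n - 1) : ℤ)
      else 2 * (n : ℤ) - 1 - 2 * (ebn π.path n : ℤ) + (ebn π.path (n - 1) : ℤ))
  else (ebn π.path i : ℤ)

/-- The type `Dₙ` area vector (1-based index). -/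
def areaD (n : ℕ) (π : SPath) (i : ℕ) : ℤ :=
  if i = 1 then
    (if (n - 1) % 4 = 0 ∨ (n - 1) % 4 = 3 then lamD n π 1 else -lamD n π 1)
  else if i = n then
    (if (n - 1) % 4 = 0 ∨ (n - 1) % 4 = 3 then lamD n π n - ((n : ℤ) - 1)
      else (n : ℤ) - lamD n π n)
  else lamD n π i - ((i : ℤ) - 1)

def areaDList (n : ℕ) (π : SPath) : List ℤ :=
  (List.range n).map fun k => areaD n π (k + 1)

/-- The underlying (unsigned) path of the image of the type `Dₙ` zeta map. -/
def zetaDraw (n : ℕ) (π : SPath) : List Step :=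
  (((List.range (2 * n)).reverse.map (fun j =>
    sMinusR (j : ℤ) (areaDList n π) ++ sPlusL (j : ℤ) (areaDList n π))).flatten).dropLast

-- The type `Dₙ` zeta map on signed lattice paths.
open scoped Classical in
noncomputable def zetaD (n : ℕ) (π : SPath) : SPath where
  path := zetaDraw n π
  sgn :=
    if NthNFollowedByE (zetaDraw n π) n then
      (if ((Finset.Icc 1 n).filter (fun r => 0 < areaD n π r)).card % 2 = 0 then 1 else -1)
    else 1

/-- The type `Dₙ` diagonal reading word, as the list of its window entries. -/
def dDList (n : ℕ) (π : SPath) (v : Fin n → ℤ) : List ℤ :=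
  let mult : ℕ → ℤ := fun j =>
    (if j = n then (if (1 + areaD n π (n - 1) + areaD n π n) % 2 = 0 then 1 else -1) else 1) *
    (if j = 1 then
        π.sgn * (if (1 + ((n : ℤ) - 2) +
            (if (n - 1) % 4 = 0 ∨ (n - 1) % 4 = 3 then (n : ℤ) - 1 else (n : ℤ))) % 2 = 0
          then 1 else -1)
      else 1)
  let base : List ℤ :=
    ((List.range (4 * n + 4)).map (fun i =>
      ((List.finRange n).filterMap (fun j =>
        if areaD n π (j.val + 1) = -(i : ℤ) then some (mult (j.val + 1) * v j) else none)) ++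
      ((List.finRange n).reverse.filterMap (fun j =>
        if areaD n π (j.val + 1) = (i : ℤ) + 1 then some (-(mult (j.val + 1) * v j))
        else none)))).flatten
  if ((Finset.Icc 1 n).filter (fun r => 0 < areaD n π r)).card % 2 = 1 then
    (match base with
      | [] => ([] : List ℤ)
      | x :: rest => -x :: rest)
  else base

/-- The type `Dₙ` diagonal reading word. -/
def dD (n : ℕ) (π : SPath) (v : Fin n → ℤ) : Fin n → ℤ :=
  fun i => (dDList n π v).getD i.val 0

/-- Vertically labelled signed lattice paths of type `Dₙ`. -/
def VertD (n : ℕ) : Set (SPath × (Fin n → ℤ)) :=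
  {p : SPath × (Fin n → ℤ) | IsSignedLatticePath n p.1 ∧ IsSignedPerm n p.2 ∧
    (∀ i : ℕ, IsRise p.1.path i → evalSP p.2 (i : ℤ) < evalSP p.2 ((i : ℤ) + 1)) ∧
    (p.1.path.take 2 = [Step.N, Step.N] → |evalSP p.2 1| < evalSP p.2 2) ∧
    (∏ i : Fin n, (p.2 i).sign) =
      p.1.sgn * (if (lamD n p.1 (n - 1) + lamD n p.1 n) % 2 = 0 then 1 else -1)}

/-- Signed permutations with an even number of sign changes. -/
def IsSignedPermD (n : ℕ) (w : Fin n → ℤ) : Prop :=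
  IsSignedPerm n w ∧ (Finset.univ.filter (fun i => w i < 0)).card % 2 = 0

/-- Diagonally labelled signed ballot paths of type `Dₙ`. -/
def DiagD (n : ℕ) : Set (SPath × (Fin n → ℤ)) :=
  {p : SPath × (Fin n → ℤ) | IsSignedBallotPath n p.1 ∧ IsSignedPermD n p.2 ∧
    (∀ i j : ℕ, IsValley p.1.path i j →
      (j < n → evalSP p.2 ((n : ℤ) + 1 - j) < evalSP p.2 ((n : ℤ) + 1 - i)) ∧
      (j = n → p.1.sgn * evalSP p.2 1 < evalSP p.2 ((n : ℤ) + 1 - i)) ∧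
      (j = n + 1 → -(p.1.sgn * evalSP p.2 1) < evalSP p.2 ((n : ℤ) + 1 - i)) ∧
      (n + 2 ≤ j → evalSP p.2 ((n : ℤ) - j) < evalSP p.2 ((n : ℤ) + 1 - i))) ∧
    (∀ i : ℕ, IsValley p.1.path i n → ¬ NthNFollowedByE p.1.path n →
      |evalSP p.2 1| < evalSP p.2 ((n : ℤ) + 1 - i))}

/-- `(π,v)` has an (ordinary) rise labelled `(a, b)`. -/
def RiseLabD (n : ℕ) (π : SPath) (v : Fin n → ℤ) (a b : ℤ) : Prop :=
  ∃ i : ℕ, IsRise π.path i ∧ ¬(i = 1 ∧ π.path.take 2 = [Step.N, Step.N]) ∧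
    a = evalSP v (i : ℤ) ∧ b = evalSP v ((i : ℤ) + 1)

/-- `(π,v)` has a rise labelled `(± a, b)` (with `a = |v(1)|`). -/
def RiseLabPMD (n : ℕ) (π : SPath) (v : Fin n → ℤ) (a b : ℤ) : Prop :=
  IsRise π.path 1 ∧ π.path.take 2 = [Step.N, Step.N] ∧ a = |evalSP v 1| ∧ b = evalSP v 2

/-- `(β,w)` has an (ordinary) valley labelled `(x, y)` (type `Dₙ` labelling convention). -/
def ValleyLabD (n : ℕ) (β : SPath) (w : Fin n → ℤ) (x y : ℤ) : Prop :=
  ∃ i j : ℕ, IsValley β.path i j ∧ ¬(j = n ∧ ¬ NthNFollowedByE β.path n) ∧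
    x = evalSP w ((n : ℤ) + 1 - i) ∧
    y = (if j < n then evalSP w ((n : ℤ) + 1 - j)
      else if j = n then β.sgn * evalSP w 1
      else if j = n + 1 then -(β.sgn * evalSP w 1)
      else evalSP w ((n : ℤ) - j))

/-- `(β,w)` has a valley labelled `(x, ± y)` (with `y = |w(1)|`). -/
def ValleyLabPMD (n : ℕ) (β : SPath) (w : Fin n → ℤ) (x y : ℤ) : Prop :=
  ∃ i : ℕ, IsValley β.path i n ∧ ¬ NthNFollowedByE β.path n ∧
    x = evalSP w ((n : ℤ) + 1 - i) ∧ y = |evalSP w 1|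

namespace RiseValley

/-! ### Consecutive entries of lists -/

/-- `a` is immediately followed by `b` in the list `L`. -/
def AdjIn {α : Type*} (L : List α) (a b : α) : Prop :=
  ∃ i : ℕ, L[i]? = some a ∧ L[i + 1]? = some b

section AdjIn

variable {α γ : Type*}

@[simp] theorem not_adjIn_nil (a b : α) : ¬ AdjIn [] a b := by simp [AdjIn]

@[simp] theorem adjIn_cons (c : α) (L : List α) (a b : α) :
    AdjIn (c :: L) a b ↔ (c = a ∧ L.head? = some b) ∨ AdjIn L a b := by
  constructor
  · rintro ⟨i, h1, h2⟩
    cases i with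
    | zero => left; simpa [List.head?_eq_getElem?] using And.intro h1 h2
    | succ i => right; exact ⟨i, by simpa using h1, by simpa using h2⟩
  · rintro (⟨h1, h2⟩ | ⟨i, h1, h2⟩)
    · exact ⟨0, by simp [h1], by simpa [List.head?_eq_getElem?] using h2⟩
    · exact ⟨i + 1, by simpa using h1, by simpa using h2⟩

theorem adjIn_append (X Y : List α) (a b : α) :
    AdjIn (X ++ Y) a b ↔
      AdjIn X a b ∨ (X.getLast? = some a ∧ Y.head? = some b) ∨ AdjIn Y a b := by
  induction X with
  | nil => simp
  | cons c X ih =>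
    cases X with
    | nil => simp
    | cons d X =>
      rw [List.cons_append, adjIn_cons, ih, adjIn_cons (c := c)]
      simp only [List.cons_append, List.head?_cons, List.getLast?_cons_cons]
      tauto

theorem adjIn_reverse (L : List α) (a b : α) : AdjIn L.reverse a b ↔ AdjIn L b a := by
  induction L with
  | nil => simp
  | cons c L ih =>
    rw [List.reverse_cons, adjIn_append, ih, adjIn_cons]
    simp
    tauto

theorem adjIn_map (f : α → γ) (L : List α) (x y : γ) :
    AdjIn (L.map f) x y ↔ ∃ a b, AdjIn L a b ∧ f a = x ∧ f b = y := by
  constructor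
  · rintro ⟨i, h1, h2⟩
    simp only [List.getElem?_map, Option.map_eq_some_iff] at h1 h2
    obtain ⟨a, ha, rfl⟩ := h1
    obtain ⟨b, hb, rfl⟩ := h2
    exact ⟨a, b, ⟨i, ha, hb⟩, rfl, rfl⟩
  · rintro ⟨a, b, ⟨i, ha, hb⟩, rfl, rfl⟩
    exact ⟨i, by simp [ha], by simp [hb]⟩

theorem AdjIn.filterMap {f : α → Option γ} {L : List α} {a b : α} {x y : γ}
    (h : AdjIn L a b) (ha : f a = some x) (hb : f b = some y) :
    AdjIn (L.filterMap f) x y := by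
  induction L with
  | nil => simp at h
  | cons c L ih =>
    rcases (adjIn_cons c L a b).1 h with ⟨rfl, h2⟩ | h
    · cases L with
      | nil => simp at h2
      | cons d L =>
        simp only [List.head?_cons, Option.some.injEq] at h2
        subst h2
        simp [ha, hb]
    · cases hc : f c with
      | none => rw [List.filterMap_cons_none hc]; exact ih h
      | some z => rw [List.filterMap_cons_some hc, adjIn_cons]; exact Or.inr (ih h)

end AdjIn

/-! ### Reading a labelled array -/

/-- Read the labels of the entries `j` (as North steps) and `j + 1` (as East steps). -/
def read (j : ℤ) (D : List (ℤ × ℤ)) : List (Step × ℤ) :=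
  D.filterMap fun p =>
    if p.1 = j then some (Step.N, p.2) else if p.1 = j + 1 then some (Step.E, p.2) else none

/-- Consecutive entries decrease by at most one. -/
def Slow (D : List (ℤ × ℤ)) : Prop := D.IsChain fun p q => p.1 - 1 ≤ q.1

theorem read_append (j : ℤ) (D D' : List (ℤ × ℤ)) : read j (D ++ D') = read j D ++ read j D' := by
  simp [read]

theorem read_cons (j : ℤ) (p : ℤ × ℤ) (D : List (ℤ × ℤ)) :
    read j (p :: D) = read j [p] ++ read j D := by
  rw [← read_append, List.singleton_append]

theorem read_singleton (j : ℤ) (p : ℤ × ℤ) :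
    read j [p] = if p.1 = j then [(Step.N, p.2)]
      else if p.1 = j + 1 then [(Step.E, p.2)] else [] := by
  unfold read
  split_ifs <;> simp [*]

theorem Slow.tail {p : ℤ × ℤ} {D : List (ℤ × ℤ)} (h : Slow (p :: D)) : Slow D :=
  List.IsChain.tail h

theorem Slow.le_head {p q : ℤ × ℤ} {D : List (ℤ × ℤ)} (h : Slow (p :: q :: D)) :
    p.1 - 1 ≤ q.1 := (List.isChain_cons_cons.1 h).1

theorem head_read_of_lt {j : ℤ} {p : ℤ × ℤ} {D : List (ℤ × ℤ)} (h : Slow (p :: D))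
    (hp : j + 1 ≤ p.1) (y : ℤ) : (read j (p :: D)).head? ≠ some (Step.N, y) := by
  induction D generalizing p with
  | nil =>
    rw [read_singleton, if_neg (by omega)]
    split_ifs <;> simp
  | cons q D ih =>
    rw [read_cons, read_singleton, if_neg (by omega)]
    split_ifs with h2
    · simp
    · exact ih h.tail (by have := h.le_head; omega)

theorem read_ne_nil {j : ℤ} {p : ℤ × ℤ} {D : List (ℤ × ℤ)} (h : Slow (p :: D))
    (hp : j ≤ p.1) (hl : ∀ q ∈ (p :: D).getLast?, q.1 ≤ j) : read j (p :: D) ≠ [] := by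
  induction D generalizing p with
  | nil =>
    have : p.1 ≤ j := hl p (by simp)
    rw [read_singleton, if_pos (by omega)]
    simp
  | cons q D ih =>
    rw [read_cons, read_singleton]
    split_ifs with h1 h2
    · simp
    · simp
    · exact ih h.tail (by have := h.le_head; omega) (by simpa using hl)

theorem getLast_read {j : ℤ} {D : List (ℤ × ℤ)} (h : Slow D)
    (hl : ∀ q ∈ D.getLast?, q.1 ≤ j) (x : ℤ) : (read j D).getLast? ≠ some (Step.E, x) := by
  induction D with
  | nil => simp [read]
  | cons p D ih =>
    rw [read_cons, List.getLast?_append]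
    cases D with
    | nil =>
      have : p.1 ≤ j := hl p (by simp)
      rw [read_singleton, if_neg (c := p.1 = j + 1) (by omega)]
      split_ifs <;> simp [read]
    | cons q D =>
      have hl' : ∀ r ∈ (q :: D).getLast?, r.1 ≤ j := by simpa using hl
      have ih' := ih h.tail hl'
      cases hr : (read j (q :: D)).getLast? with
      | some z => rw [hr] at ih'; simpa using ih'
      | none =>
        rw [List.getLast?_eq_none_iff] at hr
        have h1 : p.1 ≠ j + 1 := fun h1 =>
          read_ne_nil h.tail (by have := h.le_head; omega) hl' hr
        rw [read_singleton, if_neg h1]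
        split_ifs <;> simp

theorem adjIn_read {j : ℤ} {D : List (ℤ × ℤ)} (h : Slow D) (x y : ℤ) :
    AdjIn (read j D) (Step.E, x) (Step.N, y) ↔ AdjIn D (j + 1, x) (j, y) := by
  constructor
  · intro ha
    induction D with
    | nil => simp [read] at ha
    | cons p D ih =>
      rw [read_cons, adjIn_append] at ha
      rcases ha with ha | ⟨h1, h2⟩ | ha
      · rw [read_singleton] at ha
        split_ifs at ha <;> simp at ha
      · rw [read_singleton] at h1
        split_ifs at h1 with h3 h4
        · simp at h1
        · simp only [List.getLast?_singleton, Option.some.injEq, Prod.mk.injEq, true_and] at h1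
          rw [adjIn_cons]
          refine Or.inl ⟨Prod.ext h4 h1, ?_⟩
          cases D with
          | nil => simp [read] at h2
          | cons q D =>
            have hq : q.1 = j := by
              by_contra hq
              exact head_read_of_lt h.tail (by have := h.le_head; omega) y h2
            rw [read_cons, read_singleton, if_pos hq] at h2
            simp only [List.cons_append, List.head?_cons, Option.some.injEq, Prod.mk.injEq,
              true_and] at h2
            simp [Prod.ext_iff, hq, h2]
        · simp at h1
      · rw [adjIn_cons]; exact Or.inr (ih h.tail ha)
  · intro ha
    exact ha.filterMap (by simp) (by simp)

/-! ### Doubled arrays and their reading words -/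

/-- The array indexed by `-n, …, -1, 1, …, n` obtained from the array `A` indexed by `1, …, n`. -/
def dbl (A : List (ℤ × ℤ)) : List (ℤ × ℤ) :=
  (A.map fun p => (-p.1, p.2)).reverse ++ A.map fun p => (p.1, -p.2)

/-- The labelled zeta word, reading the values from `K - 1` down to `0`. -/
def zword (A : List (ℤ × ℤ)) : ℕ → List (Step × ℤ)
  | 0 => []
  | K + 1 => read K (dbl A) ++ zword A K

/-- The diagonal reading word on the diagonals `0, …, K - 1`. -/
def diag (A : List (ℤ × ℤ)) (K : ℕ) : List ℤ :=
  (List.range K).flatMap fun i : ℕ =>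
    (A.filterMap fun p => if p.1 = -(i : ℤ) then some p.2 else none) ++
      (A.reverse.filterMap fun p => if p.1 = (i : ℤ) + 1 then some (-p.2) else none)

theorem slow_dbl {A : List (ℤ × ℤ)} (h : Slow A) (h0 : ∀ p ∈ A.head?, 0 ≤ p.1) :
    Slow (dbl A) := by
  unfold Slow dbl at *
  rw [List.isChain_append, List.isChain_reverse, List.isChain_map, List.isChain_map]
  refine ⟨h.imp fun p q hpq => by simp only; omega, h.imp fun p q hpq => by simpa using hpq, ?_⟩
  intro x hx y hy
  simp only [List.getLast?_reverse, List.head?_map, Option.mem_def, Option.map_eq_some_iff] at hx hy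
  obtain ⟨p, hp, rfl⟩ := hx
  obtain ⟨q, hq, rfl⟩ := hy
  have := h0 p hp
  have := h0 q hq
  simp only
  omega

theorem getLast_dbl {A : List (ℤ × ℤ)} (hA : A ≠ []) (hl : ∀ q ∈ A.getLast?, q.1 ≤ 0) :
    ∀ q ∈ (dbl A).getLast?, q.1 ≤ 0 := by
  intro q hq
  rw [dbl, List.getLast?_append_of_ne_nil _ (by simpa using hA), List.getLast?_map] at hq
  simp only [Option.mem_def, Option.map_eq_some_iff] at hq
  obtain ⟨p, hp, rfl⟩ := hq
  exact hl p hp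

theorem adjIn_dbl {A : List (ℤ × ℤ)} (h0 : ∀ p ∈ A.head?, 0 ≤ p.1) (j : ℕ) (x y : ℤ) :
    AdjIn (dbl A) ((j : ℤ) + 1, x) ((j : ℤ), y) ↔ ∃ p q, AdjIn A p q ∧
      ((q.1 = -(j : ℤ) - 1 ∧ p.1 = -(j : ℤ) ∧ x = q.2 ∧ y = p.2) ∨
        (p.1 = (j : ℤ) + 1 ∧ q.1 = j ∧ x = -p.2 ∧ y = -q.2)) := by
  rw [dbl, adjIn_append, adjIn_reverse, adjIn_map, adjIn_map]
  constructor
  · rintro (⟨p, q, h, h1, h2⟩ | ⟨h1, h2⟩ | ⟨p, q, h, h1, h2⟩)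
    · simp only [Prod.mk.injEq] at h1 h2
      exact ⟨p, q, h, Or.inl ⟨by omega, by omega, h2.2.symm, h1.2.symm⟩⟩
    · simp only [List.getLast?_reverse, List.head?_map, Option.map_eq_some_iff, Prod.mk.injEq]
        at h1 h2
      obtain ⟨p, hp, hp1, -⟩ := h1
      have := h0 p hp
      omega
    · simp only [Prod.mk.injEq] at h1 h2
      exact ⟨p, q, h, Or.inr ⟨h1.1, h2.1, h1.2.symm, h2.2.symm⟩⟩
  · rintro ⟨p, q, h, (⟨h1, h2, rfl, rfl⟩ | ⟨h1, h2, rfl, rfl⟩)⟩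
    · exact Or.inl ⟨p, q, h, by simp [h2], by rw [h1]; simp [add_comm]⟩
    · exact Or.inr (Or.inr ⟨p, q, h, by simp [h1], by simp [h2]⟩)

theorem adjIn_zword_of_read {A : List (ℤ × ℤ)} {K j : ℕ} (hj : j < K) {s t : Step × ℤ}
    (h : AdjIn (read j (dbl A)) s t) : AdjIn (zword A K) s t := by
  induction K with
  | zero => omega
  | succ K ih =>
    rw [zword, adjIn_append]
    rcases Nat.lt_succ_iff_lt_or_eq.1 hj with hj | rfl
    · exact Or.inr (Or.inr (ih hj))
    · exact Or.inl h

/-- Valleys of the zeta word come from consecutive entries of the array. -/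
theorem adjIn_zword {A : List (ℤ × ℤ)} (h : Slow A) (h0 : ∀ p ∈ A.head?, 0 ≤ p.1)
    (hA : A ≠ []) (hl : ∀ q ∈ A.getLast?, q.1 ≤ 0) {K : ℕ} (hK : ∀ p ∈ A, |p.1| < K) (x y : ℤ) :
    AdjIn (zword A K) (Step.E, x) (Step.N, y) ↔ ∃ p q, AdjIn A p q ∧ q.1 = p.1 - 1 ∧
      ((p.1 ≤ 0 ∧ x = q.2 ∧ y = p.2) ∨ (1 ≤ p.1 ∧ x = -p.2 ∧ y = -q.2)) := by
  have key : AdjIn (zword A K) (Step.E, x) (Step.N, y) ↔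
      ∃ j < K, AdjIn (read j (dbl A)) (Step.E, x) (Step.N, y) := by
    constructor
    · intro ha
      clear hK
      induction K with
      | zero => simp [zword] at ha
      | succ K ih =>
        rw [zword, adjIn_append] at ha
        rcases ha with ha | ⟨ha, -⟩ | ha
        · exact ⟨K, by omega, ha⟩
        · exact absurd ha (getLast_read (slow_dbl h h0)
            (fun q hq => (getLast_dbl hA hl q hq).trans (by positivity)) x)
        · obtain ⟨j, hj, hj'⟩ := ih ha
          exact ⟨j, by omega, hj'⟩
    · rintro ⟨j, hj, ha⟩
      exact adjIn_zword_of_read hj ha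
  rw [key]
  simp only [adjIn_read (slow_dbl h h0), adjIn_dbl h0]
  constructor
  · rintro ⟨j, hj, p, q, ha, (⟨h1, h2, rfl, rfl⟩ | ⟨h1, h2, rfl, rfl⟩)⟩
    · exact ⟨p, q, ha, by omega, Or.inl ⟨by omega, rfl, rfl⟩⟩
    · exact ⟨p, q, ha, by omega, Or.inr ⟨by omega, rfl, rfl⟩⟩
  · rintro ⟨p, q, ha, h1, (⟨h2, rfl, rfl⟩ | ⟨h2, rfl, rfl⟩)⟩
    · have hp : p ∈ A := by obtain ⟨i, hi, -⟩ := ha; exact List.mem_of_getElem? hi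
      have := abs_lt.1 (hK p hp)
      exact ⟨(-p.1).toNat, by omega, p, q, ha, Or.inl ⟨by omega, by omega, rfl, rfl⟩⟩
    · have hp : p ∈ A := by obtain ⟨i, hi, -⟩ := ha; exact List.mem_of_getElem? hi
      have := abs_lt.1 (hK p hp)
      exact ⟨(p.1 - 1).toNat, by omega, p, q, ha, Or.inr ⟨by omega, by omega, rfl, rfl⟩⟩

theorem getLast_zword {A : List (ℤ × ℤ)} (h : Slow A) (h0 : ∀ p ∈ A.head?, 0 ≤ p.1)
    (hA : A ≠ []) (hl : ∀ q ∈ A.getLast?, q.1 ≤ 0) {K : ℕ} (hK : 0 < K) :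
    ∃ y, (zword A K).getLast? = some (Step.N, y) := by
  induction K with
  | zero => omega
  | succ K ih =>
    rw [zword]
    rcases Nat.eq_zero_or_pos K with rfl | hK
    · have h1 : read 0 A ≠ [] := by
        cases A with
        | nil => exact absurd rfl hA
        | cons p A => exact read_ne_nil h (h0 p (by simp)) hl
      have h2 : read 0 (dbl A) ≠ [] := by
        have h3 : (read 0 A).map Prod.fst = (read 0 (A.map fun p => (p.1, -p.2))).map Prod.fst := by
          simp only [read, List.map_filterMap, List.filterMap_map]
          congr 1
          funext p
          simp only [Function.comp]
          split_ifs <;> rfl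
        rw [dbl, read_append]
        intro h4
        rw [List.append_eq_nil_iff] at h4
        rw [h4.2] at h3
        simp at h3
        exact h1 h3
      have h3 := getLast_read (slow_dbl h h0) (getLast_dbl hA hl)
      rw [zword, List.append_nil, Nat.cast_zero]
      rcases hx : (read 0 (dbl A)).getLast? with _ | ⟨_ | _, y⟩
      · exact absurd (List.getLast?_eq_none_iff.1 hx) h2
      · exact ⟨y, rfl⟩
      · exact absurd hx (h3 y)
    · obtain ⟨y, hy⟩ := ih hK
      exact ⟨y, by rw [List.getLast?_append, hy]; rfl⟩

/-! ### Labels of the North and East steps -/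

/-- The labels of the steps equal to `s`. -/
def labels (s : Step) (C : List (Step × ℤ)) : List ℤ :=
  C.filterMap fun p => if p.1 = s then some p.2 else none

theorem labels_append (s : Step) (C C' : List (Step × ℤ)) :
    labels s (C ++ C') = labels s C ++ labels s C' := by simp [labels]

theorem labels_getElem? {s : Step} {C : List (Step × ℤ)} {p : ℕ} {x : ℤ}
    (h : C[p]? = some (s, x)) :
    (labels s C)[((C.map Prod.fst).take p).count s]? = some x := by
  induction C generalizing p with
  | nil => simp at h
  | cons c C ih =>
    obtain ⟨t, z⟩ := c
    cases p with
    | zero =>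
      simp only [List.getElem?_cons_zero, Option.some.injEq, Prod.mk.injEq] at h
      simp [labels, h.1, h.2]
    | succ p =>
      simp only [List.getElem?_cons_succ] at h
      have ih' := ih h
      by_cases hts : t = s
      · have : labels s ((t, z) :: C) = z :: labels s C := by simp [labels, hts]
        rw [this]
        simpa [hts] using ih'
      · have : labels s ((t, z) :: C) = labels s C := by simp [labels, hts]
        rw [this]
        simpa [List.count_cons, hts] using ih'

theorem labels_read_N (j : ℤ) (D : List (ℤ × ℤ)) :
    labels Step.N (read j D) = D.filterMap fun p => if p.1 = j then some p.2 else none := by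
  simp only [labels, read, List.filterMap_filterMap]
  congr 1
  funext p
  split_ifs <;> simp

theorem labels_read_E (j : ℤ) (D : List (ℤ × ℤ)) :
    labels Step.E (read j D) = D.filterMap fun p => if p.1 = j + 1 then some p.2 else none := by
  simp only [labels, read, List.filterMap_filterMap]
  congr 1
  funext p
  split_ifs <;> first | omega | simp

/-- The labels of the entries `-j`, in decreasing order of position. -/
def negPart (A : List (ℤ × ℤ)) (j : ℤ) : List ℤ :=
  A.reverse.filterMap fun p => if p.1 = -j then some p.2 else none

/-- The negated labels of the entries `j`, in increasing order of position. -/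
def posPart (A : List (ℤ × ℤ)) (j : ℤ) : List ℤ :=
  A.filterMap fun p => if p.1 = j then some (-p.2) else none

theorem filterMap_dbl (A : List (ℤ × ℤ)) (j : ℤ) :
    ((dbl A).filterMap fun p => if p.1 = j then some p.2 else none) =
      negPart A j ++ posPart A j := by
  rw [dbl, List.filterMap_append, ← List.map_reverse, List.filterMap_map, List.filterMap_map]
  simp only [negPart, posPart, Function.comp_def, neg_eq_iff_eq_neg]

theorem diag_succ_reverse (A : List (ℤ × ℤ)) (K : ℕ) :
    (diag A (K + 1)).reverse = posPart A (K + 1) ++ negPart A K ++ (diag A K).reverse := by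
  simp [diag, List.range_succ, negPart, posPart, List.flatMap_append, List.filterMap_reverse]

theorem posPart_append_labels (A : List (ℤ × ℤ)) (K : ℕ) :
    posPart A K ++ labels Step.N (zword A K) = (diag A K).reverse ++ posPart A 0 := by
  induction K with
  | zero => simp [zword, diag, labels]
  | succ K ih =>
    rw [zword, labels_append, labels_read_N, filterMap_dbl, List.append_assoc, ih,
      diag_succ_reverse]
    simp

theorem negPart_append_diag (A : List (ℤ × ℤ)) (K : ℕ) :
    negPart A K ++ (diag A K).reverse = labels Step.E (zword A K) ++ negPart A 0 := by
  induction K with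
  | zero => simp [zword, diag, labels]
  | succ K ih =>
    rw [zword, labels_append, labels_read_E, filterMap_dbl, List.append_assoc, ← ih,
      diag_succ_reverse]
    simp

theorem parts_eq_nil {A : List (ℤ × ℤ)} {K : ℕ} (hK : ∀ p ∈ A, |p.1| < K) :
    posPart A K = [] ∧ negPart A K = [] := by
  simp only [posPart, negPart, List.filterMap_eq_nil_iff, List.mem_reverse]
  constructor <;>
  · intro p hp
    have := abs_lt.1 (hK p hp)
    rw [if_neg (by omega)]

/-- The labels of the zero entries, in increasing order of position. -/
def zeros (A : List (ℤ × ℤ)) : List ℤ :=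
  A.filterMap fun p => if p.1 = 0 then some p.2 else none

theorem negPart_zero (A : List (ℤ × ℤ)) : negPart A 0 = (zeros A).reverse := by
  simp [negPart, zeros, List.filterMap_reverse]

theorem posPart_zero (A : List (ℤ × ℤ)) : posPart A 0 = (zeros A).map (-·) := by
  simp only [posPart, zeros, List.map_filterMap]
  congr 1
  funext p
  split_ifs <;> rfl

theorem labels_N_zword {A : List (ℤ × ℤ)} {K : ℕ} (hK : ∀ p ∈ A, |p.1| < K) :
    labels Step.N (zword A K) = (diag A K).reverse ++ (zeros A).map (-·) := by
  have := posPart_append_labels A K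
  rwa [(parts_eq_nil hK).1, List.nil_append, posPart_zero] at this

theorem diag_eq {A : List (ℤ × ℤ)} {K : ℕ} (hK : ∀ p ∈ A, |p.1| < K) :
    diag A K = zeros A ++ (labels Step.E (zword A K)).reverse := by
  have := negPart_append_diag A K
  rw [(parts_eq_nil hK).2, List.nil_append, negPart_zero] at this
  rw [← List.reverse_reverse (diag A K), this]
  simp

theorem diag_perm {A : List (ℤ × ℤ)} {K : ℕ} (hK : ∀ p ∈ A, |p.1| < K) :
    (diag A K).Perm (A.map fun p => if p.1 ≤ 0 then p.2 else -p.2) := by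
  induction A with
  | nil => simp [diag]
  | cons p A ih =>
    have ih' := ih fun q hq => hK q (List.mem_cons_of_mem _ hq)
    have hp := abs_lt.1 (hK p (by simp))
    have h1 : (diag (p :: A) K).Perm
        (((List.range K).flatMap fun i : ℕ => if p.1 = -(i : ℤ) then [p.2] else
          if p.1 = (i : ℤ) + 1 then [-p.2] else []) ++ diag A K) := by
      unfold diag
      refine List.Perm.trans ?_ (List.flatMap_append_perm _ _ _).symm
      refine List.Perm.flatMap_left _ fun i _ => ?_
      have h2 : ¬ (p.1 = -(i : ℤ) ∧ p.1 = (i : ℤ) + 1) := by omega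
      rw [List.reverse_cons, List.filterMap_append]
      by_cases h3 : p.1 = -(i : ℤ)
      · have h4 : p.1 ≠ (i : ℤ) + 1 := by omega
        rw [List.filterMap_cons_some (b := p.2) (by simp [h3])]
        simp only [if_pos h3]
        simp [h4]
      · rw [List.filterMap_cons_none (by simp [h3])]
        simp only [if_neg h3]
        by_cases h4 : p.1 = (i : ℤ) + 1
        · simp only [if_pos h4]
          rw [List.filterMap_cons_some (b := -p.2) (by simp [h4]), List.filterMap_nil,
            ← List.append_assoc]
          exact List.perm_append_comm
        · simp [h4]
    have h2 : ((List.range K).flatMap fun i : ℕ => if p.1 = -(i : ℤ) then [p.2] else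
          if p.1 = (i : ℤ) + 1 then [-p.2] else []) = [if p.1 ≤ 0 then p.2 else -p.2] := by
      have h5 : ∀ L : ℕ, ((List.range L).flatMap fun i : ℕ => if p.1 = -(i : ℤ) then [p.2] else
          if p.1 = (i : ℤ) + 1 then [-p.2] else []) =
          if -(L : ℤ) < p.1 ∧ p.1 ≤ L then [if p.1 ≤ 0 then p.2 else -p.2] else [] := by
        intro L
        induction L with
        | zero => simp
        | succ L ihL =>
          rw [List.range_succ, List.flatMap_append, ihL, List.flatMap_singleton]
          push_cast
          split_ifs <;> first | omega | simp
      rw [h5, if_pos (by omega)]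
    rw [h2] at h1
    exact h1.trans (by simpa using ih')

/-! ### Changing the first or the last entry of the array -/

theorem zword_neg_head {m : ℤ} (hm : m ≠ 0) (l : ℤ) (A : List (ℤ × ℤ)) (K : ℕ) :
    zword ((-m, -l) :: A) K = zword ((m, l) :: A) K := by
  induction K with
  | zero => rfl
  | succ K ih =>
    rw [zword, zword, ih]
    congr 1
    have h : ∀ (m l : ℤ), dbl ((m, l) :: A) = (A.map fun p => (-p.1, p.2)).reverse ++
        ([(-m, l)] ++ ([(m, -l)] ++ A.map fun p => (p.1, -p.2))) := by
      intro m l; simp [dbl]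
    rw [h, h]
    simp only [read_append, neg_neg]
    congr 1
    rw [← List.append_assoc, ← List.append_assoc]
    congr 1
    simp only [read_singleton]
    split_ifs <;> first | omega | simp

theorem diag_reflect_last (A : List (ℤ × ℤ)) (m l : ℤ) (K : ℕ) :
    diag (A ++ [(1 - m, -l)]) K = diag (A ++ [(m, l)]) K := by
  unfold diag
  congr 1
  funext i
  simp only [List.filterMap_append, List.reverse_append, List.reverse_singleton, List.append_assoc]
  congr 1
  rw [← List.append_assoc, ← List.append_assoc]
  congr 1
  simp only [List.filterMap_cons, List.filterMap_nil, neg_neg]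
  split_ifs <;> first | omega | simp

theorem zword_reflect_last (A : List (ℤ × ℤ)) {m : ℤ} (hm : 1 ≤ m) (l : ℤ) {K : ℕ}
    (hK : m < K) :
    ((zword (A ++ [(1 - m, -l)]) K).map Prod.fst).dropLast =
      ((zword (A ++ [(m, l)]) K).map Prod.fst).dropLast := by
  have h : ∀ (m l : ℤ), dbl (A ++ [(m, l)]) = [(-m, l)] ++ (dbl A ++ [(m, -l)]) := by
    intro m l; simp [dbl]
  have key : ∀ L : ℕ, ∃ X,
      read L [(m, -l)] ++ zword (A ++ [(m, l)]) L = X ++ read 0 [(m, -l)] ∧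
      read L [(1 - m, l)] ++ zword (A ++ [(1 - m, -l)]) L = X ++ read 0 [(1 - m, l)] := by
    intro L
    induction L with
    | zero => exact ⟨[], by simp [zword]⟩
    | succ L ih =>
      obtain ⟨X, h1, h2⟩ := ih
      refine ⟨read (L + 1 : ℕ) [(m, -l)] ++ read L [(-m, l)] ++ read L (dbl A) ++ X, ?_, ?_⟩
      · rw [zword, h]
        simp only [read_append, List.append_assoc, h1]
      · rw [zword, h]
        have h3 : read (L + 1 : ℕ) [(1 - m, l)] ++ read L [(-(1 - m), -l)] =
            read (L + 1 : ℕ) [(m, -l)] ++ read L [(-m, l)] := by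
          simp only [read_singleton]
          push_cast
          split_ifs <;> first | omega | simp
        simp only [read_append, List.append_assoc, neg_neg, h2]
        rw [← List.append_assoc, h3, List.append_assoc]
  obtain ⟨X, h1, h2⟩ := key K
  have h3 : read K [(m, -l)] = [] := by
    rw [read_singleton, if_neg (by simp only; omega), if_neg (by simp only; omega)]
  have h4 : read K [(1 - m, l)] = [] := by
    rw [read_singleton, if_neg (by simp only; omega), if_neg (by simp only; omega)]
  rw [h3, List.nil_append] at h1
  rw [h4, List.nil_append] at h2
  rw [h1, h2]
  simp only [read_singleton]
  split_ifs <;> first | omega | simp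

theorem diag_eq_of_le {A : List (ℤ × ℤ)} {K L : ℕ} (hK : ∀ p ∈ A, |p.1| < K) (hL : K ≤ L) :
    diag A L = diag A K := by
  induction L, hL using Nat.le_induction with
  | base => rfl
  | succ L hL ih =>
    have h1 : negPart A L = [] := (parts_eq_nil fun p hp => (hK p hp).trans_le (by omega)).2
    have h2 : posPart A (L + 1 : ℕ) = [] :=
      (parts_eq_nil fun p hp => (hK p hp).trans_le (by omega)).1
    rw [← List.reverse_inj, diag_succ_reverse, h1, ← Nat.cast_succ, h2, ih]
    simp

theorem exists_first_zero {p : ℤ × ℤ} {A : List (ℤ × ℤ)} (h : Slow (p :: A)) (hp : 1 ≤ p.1)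
    (hl : ∀ q ∈ (p :: A).getLast?, q.1 ≤ 0) :
    ∃ q r, AdjIn (p :: A) q r ∧ q.1 = 1 ∧ r.1 = 0 ∧ (zeros (p :: A)).head? = some r.2 := by
  induction A generalizing p with
  | nil =>
    have : p.1 ≤ 0 := hl p (by simp)
    omega
  | cons q A ih =>
    have h1 := h.le_head
    have h2 : zeros (p :: q :: A) = zeros (q :: A) :=
      List.filterMap_cons_none (by rw [if_neg (by omega)])
    rw [h2]
    by_cases hq : q.1 = 0
    · exact ⟨p, q, by simp, by omega, hq, by simp [zeros, hq]⟩
    · obtain ⟨r, t, h3, h4⟩ := ih h.tail (by omega) (by simpa using hl)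
      exact ⟨r, t, (adjIn_cons _ _ _ _).2 (Or.inr h3), h4⟩

/-! ### Positions of steps -/

theorem count_take_succ {α : Type*} [DecidableEq α] {L : List α} {p : ℕ} {a : α}
    (h : L[p]? = some a) (s : α) :
    (L.take (p + 1)).count s = (L.take p).count s + if a = s then 1 else 0 := by
  rw [List.take_add_one, h, List.count_append]
  by_cases has : a = s <;> simp [has]

theorem eq_of_count_take_eq {α : Type*} [DecidableEq α] {L : List α} {p q : ℕ} {s : α}
    (hp : L[p]? = some s) (hq : L[q]? = some s)
    (h : (L.take p).count s = (L.take q).count s) : p = q := by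
  have key : ∀ {p q : ℕ}, L[p]? = some s → p < q →
      (L.take p).count s < (L.take q).count s := by
    intro p q hp hpq
    have h1 := count_take_succ hp s
    rw [if_pos rfl] at h1
    have h2 : (L.take (p + 1)).count s ≤ (L.take q).count s :=
      (List.take_sublist_take_left (by omega)).count_le s
    omega
  rcases lt_trichotomy p q with h1 | h1 | h1
  · have := key hp h1; omega
  · exact h1
  · have := key hq h1; omega

theorem isValley_iff (Y : List Step) (i j : ℕ) :
    IsValley Y i j ↔ ∃ p : ℕ, (Y ++ [Step.N])[p]? = some Step.E ∧
      (Y ++ [Step.N])[p + 1]? = some Step.N ∧ ((Y ++ [Step.N]).take p).count Step.E + 1 = i ∧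
      ((Y ++ [Step.N]).take (p + 1)).count Step.N + 1 = j := by
  constructor
  · rintro (⟨p, h1, h2, h3, h4⟩ | ⟨h1, h2, h3⟩)
    · have hp : p + 1 < Y.length := (List.getElem?_eq_some_iff.1 h2).1
      refine ⟨p, ?_, ?_, ?_, ?_⟩
      · rwa [List.getElem?_append_left (by omega)]
      · rwa [List.getElem?_append_left hp]
      · rwa [List.take_append_of_le_length (by omega)]
      · rwa [List.take_append_of_le_length (by omega)]
    · obtain ⟨Z, rfl⟩ := List.getLast?_eq_some_iff.1 h1
      refine ⟨Z.length, ?_, ?_, ?_, ?_⟩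
      · simp
      · simp
      · rw [h2]; simp
      · rw [h3, List.take_append_of_le_length (by simp), List.take_of_length_le (by simp)]
  · rintro ⟨p, h1, h2, h3, h4⟩
    have hp : p + 1 < (Y ++ [Step.N]).length := (List.getElem?_eq_some_iff.1 h2).1
    simp only [List.length_append, List.length_singleton] at hp
    rcases Nat.lt_or_ge (p + 1) Y.length with hp' | hp'
    · refine Or.inl ⟨p, ?_, ?_, ?_, ?_⟩
      · rwa [List.getElem?_append_left (by omega)] at h1
      · rwa [List.getElem?_append_left hp'] at h2
      · rwa [List.take_append_of_le_length (by omega)] at h3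
      · rwa [List.take_append_of_le_length (by omega)] at h4
    · have hp'' : Y.length = p + 1 := by omega
      rw [List.getElem?_append_left (by omega)] at h1
      rw [List.take_append_of_le_length (by omega)] at h3 h4
      refine Or.inr ⟨?_, ?_, ?_⟩
      · rw [List.getLast?_eq_getElem?, hp'']; simpa using h1
      · rw [← h3]
        have := count_take_succ h1 Step.E
        rw [List.take_of_length_le (by omega), if_pos rfl] at this
        exact this.symm
      · rw [← h4, List.take_of_length_le (by omega)]

theorem nthNFollowedByE_append (Y : List Step) (k : ℕ) :
    NthNFollowedByE (Y ++ [Step.N]) k ↔ NthNFollowedByE Y k := by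
  constructor
  · rintro ⟨p, h1, h2, h3⟩
    have hp : p + 1 < (Y ++ [Step.N]).length := (List.getElem?_eq_some_iff.1 h3).1
    have hp' : p + 1 ≠ Y.length := by
      intro h
      rw [h, List.getElem?_append_right le_rfl] at h3
      simp at h3
    simp only [List.length_append, List.length_singleton] at hp
    refine ⟨p, ?_, ?_, ?_⟩
    · rwa [List.getElem?_append_left (by omega)] at h1
    · rwa [List.take_append_of_le_length (by omega)] at h2
    · rwa [List.getElem?_append_left (by omega)] at h3
  · rintro ⟨p, h1, h2, h3⟩
    have hp : p + 1 < Y.length := (List.getElem?_eq_some_iff.1 h3).1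
    refine ⟨p, ?_, ?_, ?_⟩
    · rwa [List.getElem?_append_left (by omega)]
    · rwa [List.take_append_of_le_length (by omega)]
    · rwa [List.getElem?_append_left (by omega)]

theorem nthNFollowedByE_of_count {L : List Step} {k : ℕ} (hk : 1 ≤ k) {p : ℕ}
    (h1 : L[p]? = some Step.E) (h2 : (L.take (p + 1)).count Step.N = k) :
    NthNFollowedByE L k := by
  rw [count_take_succ h1, if_neg (by simp), add_zero] at h2
  induction p with
  | zero => simp at h2; omega
  | succ p ih =>
    have hp : p + 1 < L.length := (List.getElem?_eq_some_iff.1 h1).1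
    obtain ⟨s, hs⟩ : ∃ s, L[p]? = some s := ⟨_, List.getElem?_eq_getElem (by omega)⟩
    rw [count_take_succ hs] at h2
    cases s with
    | N => exact ⟨p, hs, by simpa using h2, h1⟩
    | E => exact ih hs (by simpa using h2)

/-! ### Valley labels -/

/-- The labelled word `C` ends with a North step, and its labels are those prescribed by the
diagonal reading word `d`, whose initial segment `z` collects the labels of the diagonal `0`. -/
structure IsReading (n : ℕ) (C : List (Step × ℤ)) (d z : List ℤ) (Y : List Step) : Prop where
  word_eq : C.map Prod.fst = Y ++ [Step.N]
  diag_eq : d = z ++ (labels Step.E C).reverse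
  labels_N : labels Step.N C = d.reverse ++ z.map (-·)
  zeros_ne : z ≠ []
  length_eq : d.length = n
  abs_nodup : (d.map (|·|)).Nodup
  ne_zero : ∀ x ∈ d, x ≠ 0

namespace IsReading

variable {n : ℕ} {C : List (Step × ℤ)} {d z : List ℤ} {Y : List Step}

theorem length_pos (h : IsReading n C d z Y) : 0 < z.length := List.length_pos_of_ne_nil h.zeros_ne

theorem length_le (h : IsReading n C d z Y) : z.length ≤ n := by
  have := congrArg List.length h.diag_eq
  rw [h.length_eq, List.length_append] at this
  omega

theorem n_pos (h : IsReading n C d z Y) : 0 < n := h.length_pos.trans_le h.length_le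

theorem getElem?_zeros (h : IsReading n C d z Y) {k : ℕ} (hk : k < z.length) : d[k]? = z[k]? := by
  rw [h.diag_eq, List.getElem?_append_left hk]

theorem labels_N_of_le (h : IsReading n C d z Y) {j : ℕ} (hj : 1 ≤ j) (hjn : j ≤ n) :
    (labels Step.N C)[j - 1]? = d[n - j]? := by
  have := h.length_eq
  rw [h.labels_N, List.getElem?_append_left (by simp; omega), List.getElem?_reverse (by omega)]
  congr 1
  omega

theorem labels_N_of_lt (h : IsReading n C d z Y) {j : ℕ} (hj : n < j) {y : ℤ}
    (hy : (labels Step.N C)[j - 1]? = some y) : d[j - n - 1]? = some (-y) := by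
  have := h.length_eq
  rw [h.labels_N, List.getElem?_append_right (by simp; omega), List.length_reverse, this,
    List.getElem?_map, Option.map_eq_some_iff] at hy
  obtain ⟨x, hx, rfl⟩ := hy
  have hk : j - 1 - n < z.length := (List.getElem?_eq_some_iff.1 hx).1
  rw [show j - n - 1 = j - 1 - n by omega, h.getElem?_zeros hk, hx, neg_neg]

theorem labels_N_nodup (h : IsReading n C d z Y) : (labels Step.N C).Nodup := by
  have hd : d.Nodup := List.Nodup.of_map _ h.abs_nodup
  have hz : z.Sublist d := by
    conv_rhs => rw [h.diag_eq]
    exact List.sublist_append_left _ _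
  rw [h.labels_N, List.nodup_append]
  refine ⟨List.nodup_reverse.2 hd, (hd.sublist hz).map neg_injective, ?_⟩
  intro x hx y hy hxy
  obtain ⟨u, hu, rfl⟩ := List.mem_map.1 hy
  rw [List.mem_reverse] at hx
  have hu' := hz.subset hu
  have : x = u := List.inj_on_of_nodup_map h.abs_nodup hx hu' (by simp [hxy])
  have := h.ne_zero u hu'
  omega

theorem index_eq (h : IsReading n C d z Y) {i j : ℕ} {y : ℤ} (hi : 1 ≤ i) (hj : 1 ≤ j)
    (h1 : (labels Step.N C)[i - 1]? = some y) (h2 : (labels Step.N C)[j - 1]? = some y) :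
    i = j := by
  have := (List.getElem?_inj (List.getElem?_eq_some_iff.1 h1).1 h.labels_N_nodup).1
    (h1.trans h2.symm)
  omega

theorem adjIn_of_isValley (h : IsReading n C d z Y) {i j : ℕ} (hv : IsValley Y i j) :
    ∃ x y, AdjIn C (Step.E, x) (Step.N, y) ∧ 1 ≤ i ∧ i < n ∧ d[n - i]? = some x ∧ 1 ≤ j ∧
      (labels Step.N C)[j - 1]? = some y ∧ (j = n + 1 → NthNFollowedByE Y n) := by
  obtain ⟨p, h1, h2, h3, h4⟩ := (isValley_iff Y i j).1 hv
  rw [← h.word_eq] at h1 h2 h3 h4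
  have h5 := h1
  have h6 := h2
  rw [List.getElem?_map, Option.map_eq_some_iff] at h5 h6
  obtain ⟨⟨-, x⟩, hx, rfl⟩ := h5
  obtain ⟨⟨-, y⟩, hy, rfl⟩ := h6
  have hxl := labels_getElem? hx
  have hyl := labels_getElem? hy
  have hlen := congrArg List.length h.diag_eq
  have hpos := h.length_pos
  have hi : i - 1 < (labels Step.E C).length := by
    rw [← h3]; exact (List.getElem?_eq_some_iff.1 hxl).1
  rw [h.length_eq, List.length_append, List.length_reverse] at hlen
  refine ⟨x, y, ⟨p, hx, hy⟩, by omega, by omega, ?_, by omega, ?_, ?_⟩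
  · rw [h.diag_eq, List.getElem?_append_right (by omega), List.getElem?_reverse (by omega), ← hxl]
    congr 1
    omega
  · rw [← hyl, ← h4]; rfl
  · intro hj
    rw [← nthNFollowedByE_append, ← h.word_eq]
    exact nthNFollowedByE_of_count h.n_pos h1 (by omega)

theorem isValley_of_adjIn (h : IsReading n C d z Y) {x y : ℤ}
    (ha : AdjIn C (Step.E, x) (Step.N, y)) :
    ∃ i j, IsValley Y i j ∧ 1 ≤ i ∧ i < n ∧ d[n - i]? = some x ∧ 1 ≤ j ∧
      (labels Step.N C)[j - 1]? = some y := by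
  obtain ⟨p, hx, hy⟩ := ha
  have hv : IsValley Y (((C.map Prod.fst).take p).count Step.E + 1)
      (((C.map Prod.fst).take (p + 1)).count Step.N + 1) := by
    rw [isValley_iff, ← h.word_eq]
    exact ⟨p, by rw [List.getElem?_map, hx]; rfl, by rw [List.getElem?_map, hy]; rfl, rfl, rfl⟩
  obtain ⟨x', y', -, h1, h2, h3, h4, h5, -⟩ := h.adjIn_of_isValley hv
  have hyl := labels_getElem? hy
  have hxl := labels_getElem? hx
  have hx' : x' = x := by
    have hlt := (List.getElem?_eq_some_iff.1 hxl).1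
    have hlen := congrArg List.length h.diag_eq
    rw [h.length_eq, List.length_append, List.length_reverse] at hlen
    rw [h.diag_eq, List.getElem?_append_right (by omega), List.getElem?_reverse (by omega)] at h3
    rw [← Option.some_inj, ← h3, ← hxl]
    congr 1
    omega
  have hy' : y' = y := by
    rw [← Option.some_inj, ← h5, ← hyl]
    rfl
  subst hx' hy'
  exact ⟨_, _, hv, h1, h2, h3, h4, h5⟩

variable {w : Fin n → ℤ} {d₀ s : ℤ} {β : SPath}

theorem label_formula (h : IsReading n C d z Y) (hd : d[0]? = some d₀) (hs : s * s = 1)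
    (hw1 : evalSP w 1 = s * d₀)
    (hw : ∀ k : ℕ, 1 ≤ k → k < n → d[k]? = some (evalSP w ((k : ℤ) + 1)))
    {j : ℕ} (hj : 1 ≤ j) {y : ℤ} (hy : (labels Step.N C)[j - 1]? = some y) :
    y = (if j < n then evalSP w ((n : ℤ) + 1 - j)
      else if j = n then s * evalSP w 1
      else if j = n + 1 then -(s * evalSP w 1)
      else evalSP w ((n : ℤ) - j)) := by
  have hsd : s * evalSP w 1 = d₀ := by rw [hw1, ← mul_assoc, hs, one_mul]
  rcases Nat.lt_or_ge n j with hnj | hjn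
  · have h1 := h.labels_N_of_lt hnj hy
    rw [if_neg (by omega), if_neg (by omega)]
    split_ifs with h2
    · rw [show j - n - 1 = 0 by omega, hd] at h1
      rw [hsd, Option.some_inj.1 h1, neg_neg]
    · have h3 : j - n - 1 < n := by
        have := (List.getElem?_eq_some_iff.1 h1).1
        rwa [h.length_eq] at this
      rw [hw _ (by omega) h3, Option.some_inj] at h1
      rw [← neg_neg y, ← h1]
      unfold evalSP
      rw [dif_pos (by omega), dif_neg (by omega), dif_pos (by omega)]
      congr 3
      omega
  · have h1 := h.labels_N_of_le hj hjn
    rw [hy] at h1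
    split_ifs with h2 h3
    · rw [hw _ (by omega) (by omega), Option.some_inj] at h1
      rw [h1]
      congr 1
      omega
    · rw [show n - j = 0 by omega, hd, Option.some_inj] at h1
      rw [h1, hsd]
    all_goals omega

theorem label_eq_first_iff (h : IsReading n C d z Y) (hd : d[0]? = some d₀) {j : ℕ} (hj : 1 ≤ j)
    {y : ℤ} (hy : (labels Step.N C)[j - 1]? = some y) : y = d₀ ↔ j = n := by
  have h1 : (labels Step.N C)[n - 1]? = some d₀ := by
    rw [h.labels_N_of_le h.n_pos le_rfl, Nat.sub_self, hd]
  constructor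
  · rintro rfl
    exact h.index_eq hj h.n_pos hy h1
  · rintro rfl
    rw [hy, Option.some_inj] at h1
    exact h1

theorem eval_of_index (hw : ∀ k : ℕ, 1 ≤ k → k < n → d[k]? = some (evalSP w ((k : ℤ) + 1)))
    {i : ℕ} (h1 : 1 ≤ i) (h2 : i < n) {x : ℤ} (hx : d[n - i]? = some x) :
    x = evalSP w ((n : ℤ) + 1 - i) := by
  rw [hw _ (by omega) (by omega), Option.some_inj] at hx
  rw [← hx]
  congr 1
  omega

theorem valleyLabD_iff (h : IsReading n C d z Y) (hd : d[0]? = some d₀) (hs : s * s = 1)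
    (hw1 : evalSP w 1 = s * d₀)
    (hw : ∀ k : ℕ, 1 ≤ k → k < n → d[k]? = some (evalSP w ((k : ℤ) + 1)))
    (hβ : β.path = Y) (hsgn : NthNFollowedByE Y n → β.sgn = s) (x y : ℤ) :
    ValleyLabD n β w x y ↔ AdjIn C (Step.E, x) (Step.N, y) ∧
      ¬ (y = d₀ ∧ ¬ NthNFollowedByE Y n) := by
  subst hβ
  constructor
  · rintro ⟨i, j, hv, hF, rfl, hy⟩
    obtain ⟨x', y', ha, h1, h2, h3, h4, h5, h6⟩ := h.adjIn_of_isValley hv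
    have hx := eval_of_index hw h1 h2 h3
    have hy' := h.label_formula hd hs hw1 hw h4 h5
    have hyy : y = y' := by
      rw [hy, hy']
      split_ifs with c1 c2 c3
      · rfl
      · rw [hsgn (by tauto)]
      · rw [hsgn (h6 c3)]
      · rfl
    rw [← hx, hyy, h.label_eq_first_iff hd h4 h5]
    exact ⟨ha, hF⟩
  · rintro ⟨ha, hF⟩
    obtain ⟨i, j, hv, h1, h2, h3, h4, h5⟩ := h.isValley_of_adjIn ha
    obtain ⟨-, -, -, -, -, -, -, -, h6⟩ := h.adjIn_of_isValley hv
    rw [h.label_eq_first_iff hd h4 h5] at hF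
    refine ⟨i, j, hv, hF, eval_of_index hw h1 h2 h3, ?_⟩
    rw [h.label_formula hd hs hw1 hw h4 h5]
    split_ifs with c1 c2 c3
    · rfl
    · rw [hsgn (by tauto)]
    · rw [hsgn (h6 c3)]
    · rfl

theorem valleyLabPMD_iff (h : IsReading n C d z Y) (hd : d[0]? = some d₀) (hs : s * s = 1)
    (hw1 : evalSP w 1 = s * d₀)
    (hw : ∀ k : ℕ, 1 ≤ k → k < n → d[k]? = some (evalSP w ((k : ℤ) + 1)))
    (hβ : β.path = Y) (x y : ℤ) :
    ValleyLabPMD n β w x y ↔ AdjIn C (Step.E, x) (Step.N, d₀) ∧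
      ¬ NthNFollowedByE Y n ∧ y = |d₀| := by
  subst hβ
  have habs : |evalSP w 1| = |d₀| := by
    have : |s| = 1 := by
      rcases mul_self_eq_one_iff.1 hs with rfl | rfl <;> simp
    rw [hw1, abs_mul, this, one_mul]
  constructor
  · rintro ⟨i, hv, hF, rfl, hy⟩
    obtain ⟨x', y', ha, h1, h2, h3, h4, h5, -⟩ := h.adjIn_of_isValley hv
    rw [(h.label_eq_first_iff hd h4 h5).2 rfl] at ha
    rw [← eval_of_index hw h1 h2 h3, hy, habs]
    exact ⟨ha, hF, rfl⟩
  · rintro ⟨ha, hF, rfl⟩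
    obtain ⟨i, j, hv, h1, h2, h3, h4, h5⟩ := h.isValley_of_adjIn ha
    obtain rfl := (h.label_eq_first_iff hd h4 h5).1 rfl
    exact ⟨i, hv, hF, eval_of_index hw h1 h2 h3, habs.symm⟩

/-- A valley labelled by the opposite of the first diagonal label makes the `n`-th North step
be followed by an East step. -/
theorem nthNFollowedByE_of_adjIn_neg (h : IsReading n C d z Y) (hd : d[0]? = some d₀) {x : ℤ}
    (ha : AdjIn C (Step.E, x) (Step.N, -d₀)) : NthNFollowedByE Y n := by
  obtain ⟨i, j, hv, h1, h2, h3, h4, h5⟩ := h.isValley_of_adjIn ha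
  obtain ⟨-, -, -, -, -, -, -, -, h6⟩ := h.adjIn_of_isValley hv
  have h7 : (labels Step.N C)[n + 1 - 1]? = some (-d₀) := by
    have := h.length_eq
    rw [h.labels_N, List.getElem?_append_right (by simp; omega), List.length_reverse, this,
      Nat.add_sub_cancel, Nat.sub_self, List.getElem?_map, ← h.getElem?_zeros h.length_pos, hd]
    rfl
  exact h6 (h.index_eq h4 (by omega) h5 h7)

theorem not_nthNFollowedByE_of_adjIn (h : IsReading n C d z Y) (hd : d[0]? = some d₀) {y : ℤ}
    (ha : AdjIn C (Step.N, d₀) (Step.N, y)) : ¬ NthNFollowedByE Y n := by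
  rw [← nthNFollowedByE_append, ← h.word_eq]
  rintro ⟨q, h1, h2, h3⟩
  obtain ⟨p, hp, hp'⟩ := ha
  have h4 := labels_getElem? hp
  have h5 := (h.label_eq_first_iff hd (j := ((C.map Prod.fst).take p).count Step.N + 1)
    (by omega) h4).1 rfl
  have h6 : p = q := eq_of_count_take_eq (s := Step.N) (by rw [List.getElem?_map, hp]; rfl) h1
    (by omega)
  rw [← h6, List.getElem?_map, hp'] at h3
  simp at h3

end IsReading

theorem eq_append_of_getLast {C : List (Step × ℤ)} {y : ℤ} (h : C.getLast? = some (Step.N, y)) :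
    C.map Prod.fst = (C.map Prod.fst).dropLast ++ [Step.N] := by
  obtain ⟨Z, rfl⟩ := List.getLast?_eq_some_iff.1 h
  simp

theorem isReading_of_array {A A' : List (ℤ × ℤ)} (h : Slow A) (h0 : ∀ p ∈ A.head?, 0 ≤ p.1)
    (hl : ∀ q ∈ A.getLast?, q.1 ≤ 0) {K : ℕ} (hK0 : 0 < K) (hK : ∀ p ∈ A', |p.1| < K)
    (hz : zeros A' = zeros A) (hC : zword A' K = zword A K) (hA : A ≠ [])
    (hnd : (A'.map fun p => |p.2|).Nodup) (hne : ∀ p ∈ A', p.2 ≠ 0) {Y : List Step}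
    (hY : Y = ((zword A K).map Prod.fst).dropLast) :
    IsReading A'.length (zword A K) (diag A' K) (zeros A) Y where
  word_eq := by
    obtain ⟨y, hy⟩ := getLast_zword h h0 hA hl hK0
    rw [hY, ← eq_append_of_getLast hy]
  diag_eq := by rw [diag_eq hK, hz, hC]
  labels_N := by rw [← hC, labels_N_zword hK, hz]
  zeros_ne := by
    cases A with
    | nil => exact absurd rfl hA
    | cons p A =>
      rcases (h0 p (by simp)).eq_or_lt with hp | hp
      · simp [zeros, ← hp]
      · obtain ⟨q, r, -, -, -, h4⟩ := exists_first_zero h hp hl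
        intro h5
        rw [h5] at h4
        simp at h4
  length_eq := by rw [(diag_perm hK).length_eq, List.length_map]
  abs_nodup := by
    rw [((diag_perm hK).map _).nodup_iff, List.map_map]
    convert hnd using 2
    funext p
    simp only [Function.comp]
    split_ifs <;> simp
  ne_zero := by
    intro x hx
    rw [(diag_perm hK).mem_iff, List.mem_map] at hx
    obtain ⟨p, hp, rfl⟩ := hx
    have := hne p hp
    split_ifs <;> omega

theorem adjIn_map_range {α : Type*} (f : ℕ → α) (n : ℕ) (a b : α) :
    AdjIn ((List.range n).map f) a b ↔ ∃ k, k + 1 < n ∧ a = f k ∧ b = f (k + 1) := by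
  constructor
  · rintro ⟨k, h1, h2⟩
    have hk : k + 1 < n := by simpa using (List.getElem?_eq_some_iff.1 h2).1
    refine ⟨k, hk, ?_, ?_⟩
    · simpa [List.getElem?_range (show k < n by omega), eq_comm] using h1
    · simpa [List.getElem?_range hk, eq_comm] using h2
  · rintro ⟨k, hk, rfl, rfl⟩
    exact ⟨k, by simp [List.getElem?_range (show k < n by omega)],
      by simp [List.getElem?_range hk]⟩

/-- The array with values `ν 1, …, ν n` and labels `l 1, …, l n`. -/
def arr (n : ℕ) (ν l : ℕ → ℤ) : List (ℤ × ℤ) :=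
  (List.range n).map fun k => (ν (k + 1), l (k + 1))

theorem adjIn_arr (n : ℕ) (ν l : ℕ → ℤ) (p q : ℤ × ℤ) :
    AdjIn (arr n ν l) p q ↔
      ∃ i, 1 ≤ i ∧ i < n ∧ p = (ν i, l i) ∧ q = (ν (i + 1), l (i + 1)) := by
  rw [arr, adjIn_map_range]
  constructor
  · rintro ⟨k, hk, h1, h2⟩
    exact ⟨k + 1, by omega, hk, h1, h2⟩
  · rintro ⟨i, hi, hin, h1, h2⟩
    obtain ⟨k, rfl⟩ := Nat.exists_eq_add_of_le' hi
    exact ⟨k, hin, h1, h2⟩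

theorem arr_add_two (m : ℕ) (ν l : ℕ → ℤ) :
    arr (m + 2) ν l = (ν 1, l 1) ::
      ((List.range m).map fun k => (ν (k + 2), l (k + 2))) ++ [(ν (m + 2), l (m + 2))] := by
  rw [arr, List.range_succ, List.range_succ_eq_map]
  simp [Function.comp_def]

/-- The array is in normal form: it starts with a nonnegative entry, ends with a nonpositive entry,
and decreases by at most one at each step. -/
structure IsNormal (n : ℕ) (ν : ℕ → ℤ) : Prop where
  two_le : 2 ≤ n
  first : 0 ≤ ν 1
  last : ν n ≤ 0
  slow : ∀ i, 1 ≤ i → i < n → ν i - 1 ≤ ν (i + 1)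
  bound : ∀ i, 1 ≤ i → i ≤ n → |ν i| < (2 * n : ℕ)

namespace IsNormal

variable {n : ℕ} {ν l : ℕ → ℤ}

theorem head_arr (h : IsNormal n ν) : (arr n ν l).head? = some (ν 1, l 1) := by
  obtain ⟨m, rfl⟩ := Nat.exists_eq_add_of_le' h.two_le
  rw [arr_add_two]
  rfl

theorem head_nonneg (h : IsNormal n ν) : ∀ p ∈ (arr n ν l).head?, 0 ≤ p.1 := by
  rw [h.head_arr]
  rintro p ⟨⟩
  exact h.first

theorem arr_ne_nil (h : IsNormal n ν) : arr n ν l ≠ [] := by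
  intro h1
  have := h.head_arr (l := l)
  rw [h1] at this
  simp at this

theorem last_nonpos (h : IsNormal n ν) : ∀ p ∈ (arr n ν l).getLast?, p.1 ≤ 0 := by
  obtain ⟨m, rfl⟩ := Nat.exists_eq_add_of_le' h.two_le
  rw [arr_add_two, List.getLast?_append]
  rintro p ⟨⟩
  exact h.last

theorem slow_arr (h : IsNormal n ν) : Slow (arr n ν l) := by
  rw [Slow, List.isChain_iff_getElem]
  intro i hi
  have hi' : i + 1 < n := by simpa [arr] using hi
  simpa [arr] using h.slow (i + 1) (by omega) hi'

theorem bound_arr (h : IsNormal n ν) : ∀ p ∈ arr n ν l, |p.1| < (2 * n : ℕ) := by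
  intro p hp
  obtain ⟨k, hk, rfl⟩ := List.mem_map.1 hp
  exact h.bound (k + 1) (by omega) (List.mem_range.1 hk)

theorem adjIn_zword (h : IsNormal n ν) (x y : ℤ) :
    AdjIn (zword (arr n ν l) (2 * n)) (Step.E, x) (Step.N, y) ↔
      ∃ i, 1 ≤ i ∧ i < n ∧ ν (i + 1) = ν i - 1 ∧
        ((ν i ≤ 0 ∧ x = l (i + 1) ∧ y = l i) ∨ (1 ≤ ν i ∧ x = -l i ∧ y = -l (i + 1))) := by
  rw [RiseValley.adjIn_zword h.slow_arr h.head_nonneg h.arr_ne_nil h.last_nonpos h.bound_arr]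
  simp only [adjIn_arr]
  constructor
  · rintro ⟨p, q, ⟨i, h1, h2, rfl, rfl⟩, h3⟩
    exact ⟨i, h1, h2, h3⟩
  · rintro ⟨i, h1, h2, h3⟩
    exact ⟨_, _, ⟨i, h1, h2, rfl, rfl⟩, h3⟩

variable {d : List ℤ} {Y : List Step} {d₀ : ℤ}

theorem first_label (h : IsNormal n ν)
    (hr : IsReading n (zword (arr n ν l) (2 * n)) d (zeros (arr n ν l)) Y) (hd : d[0]? = some d₀)
    (h1 : ν 1 = 0) : d₀ = l 1 := by
  rw [hr.getElem?_zeros hr.length_pos] at hd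
  obtain ⟨m, rfl⟩ := Nat.exists_eq_add_of_le' h.two_le
  rw [arr_add_two, List.cons_append, zeros, List.filterMap_cons_some (b := l 1) (by simp [h1])] at hd
  simpa [eq_comm] using hd

theorem first_valley_iff (h : IsNormal n ν)
    (hr : IsReading n (zword (arr n ν l) (2 * n)) d (zeros (arr n ν l)) Y) (hd : d[0]? = some d₀)
    (hinj : ∀ i j, 1 ≤ i → i ≤ n → 1 ≤ j → j ≤ n → |l i| = |l j| → i = j) (x : ℤ) :
    (AdjIn (zword (arr n ν l) (2 * n)) (Step.E, x) (Step.N, d₀) ∧ ¬ NthNFollowedByE Y n) ↔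
      ν 1 = 0 ∧ ν 2 = -1 ∧ x = l 2 := by
  have hn := h.two_le
  constructor
  · rintro ⟨ha, hF⟩
    have h1 : ν 1 = 0 := by
      by_contra h1
      have hf := h.first
      obtain ⟨p, q, h2, h3, h4, h5⟩ : ∃ q r, AdjIn (arr n ν l) q r ∧ q.1 = 1 ∧ r.1 = 0 ∧
          (zeros (arr n ν l)).head? = some r.2 := by
        have hA := h.head_arr (l := l)
        have hs := h.slow_arr (l := l)
        have hl := h.last_nonpos (l := l)
        generalize arr n ν l = A at hA hs hl
        cases A with
        | nil => simp at hA
        | cons p A =>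
          obtain rfl : p = (ν 1, l 1) := by simpa using hA
          exact exists_first_zero hs (by simp only; omega) hl
      have h6 : q.2 = d₀ := by
        rw [hr.getElem?_zeros hr.length_pos, ← List.head?_eq_getElem?, h5] at hd
        simpa using hd
      refine hF (hr.nthNFollowedByE_of_adjIn_neg hd (x := -p.2) ?_)
      rw [RiseValley.adjIn_zword h.slow_arr h.head_nonneg h.arr_ne_nil h.last_nonpos h.bound_arr]
      exact ⟨p, q, h2, by omega, Or.inr ⟨by omega, rfl, by rw [h6]⟩⟩
    have h2 := h.first_label hr hd h1
    obtain ⟨i, hi, hin, h3, (⟨-, h4, h5⟩ | ⟨-, h4, h5⟩)⟩ := (h.adjIn_zword x d₀).1 ha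
    · obtain rfl : 1 = i := hinj 1 i le_rfl (by omega) hi (by omega) (by rw [← h2, h5])
      exact ⟨h1, by rw [h3, h1]; norm_num, h4⟩
    · have := hinj 1 (i + 1) le_rfl (by omega) (by omega) (by omega) (by rw [← h2, h5, abs_neg])
      omega
  · rintro ⟨h1, h2, rfl⟩
    have h3 := h.first_label hr hd h1
    refine ⟨(h.adjIn_zword _ _).2 ⟨1, le_rfl, by omega, by rw [h1, h2]; norm_num,
      Or.inl ⟨h1.le, rfl, h3⟩⟩, hr.not_nthNFollowedByE_of_adjIn hd (y := -d₀) ?_⟩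
    refine adjIn_zword_of_read (j := 0) (by omega) ?_
    have h4 : AdjIn (dbl (arr n ν l)) (0, d₀) (0, -d₀) := by
      rw [dbl, adjIn_append]
      refine Or.inr (Or.inl ⟨?_, ?_⟩)
      · rw [List.getLast?_reverse, List.head?_map, h.head_arr, h1, h3]
        rfl
      · rw [List.head?_map, h.head_arr, h1, h3]
        rfl
    exact h4.filterMap (by simp) (by simp)

end IsNormal

/-- The comparison of rises and valleys for an array in normal form. -/
theorem rise_valley_of_normal {n : ℕ} {ν l V : ℕ → ℤ} (h : IsNormal n ν) {d : List ℤ}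
    {Y : List Step} {d₀ s : ℤ} {w v : Fin n → ℤ} {π β : SPath}
    (hr : IsReading n (zword (arr n ν l) (2 * n)) d (zeros (arr n ν l)) Y)
    (hV : ∀ i : ℕ, evalSP v i = V i)
    (hinj : ∀ i j, 1 ≤ i → i ≤ n → 1 ≤ j → j ≤ n → |V i| = |V j| → i = j)
    (hne : ∀ i, 1 ≤ i → i ≤ n → V i ≠ 0)
    (habs : ∀ i, 1 ≤ i → i ≤ n → |l i| = |V i|)
    (hrise : ∀ i, IsRise π.path i ↔ 1 ≤ i ∧ i < n ∧ ν (i + 1) = ν i - 1)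
    (hNN : π.path.take 2 = [Step.N, Step.N] ↔ ν 1 = 0 ∧ ν 2 = -1)
    (hlab : ∀ i, 1 ≤ i → i < n → ν (i + 1) = ν i - 1 →
      (¬ (i = 1 ∧ ν 1 = 0) → l i = V i) ∧ l (i + 1) = V (i + 1))
    (hd : d[0]? = some d₀) (hs : s * s = 1) (hw1 : evalSP w 1 = s * d₀)
    (hw : ∀ k : ℕ, 1 ≤ k → k < n → d[k]? = some (evalSP w ((k : ℤ) + 1)))
    (hβ : β.path = Y) (hsgn : NthNFollowedByE Y n → β.sgn = s)
    (a b : ℤ) (ha : ∃ k, 1 ≤ k ∧ k ≤ n ∧ V k = a) (hb : ∃ k, 1 ≤ k ∧ k ≤ n ∧ V k = b) :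
    (RiseLabD n π v a b ↔ (ValleyLabD n β w b a ∨ ValleyLabD n β w (-a) (-b))) ∧
      (RiseLabPMD n π v |a| b ↔ ValleyLabPMD n β w b |a|) := by
  have hn := h.two_le
  have hinj' : ∀ i j, 1 ≤ i → i ≤ n → 1 ≤ j → j ≤ n → |l i| = |l j| → i = j := by
    intro i j h1 h2 h3 h4 h5
    exact hinj i j h1 h2 h3 h4 (by rwa [← habs i h1 h2, ← habs j h3 h4])
  have hsign : ∀ {c : ℤ}, (∃ k, 1 ≤ k ∧ k ≤ n ∧ V k = c) → ∀ i, 1 ≤ i → i ≤ n → c ≠ -V i := by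
    rintro c ⟨k, h1, h2, rfl⟩ i h3 h4 h5
    obtain rfl := hinj k i h1 h2 h3 h4 (by rw [h5, abs_neg])
    have := hne k h1 h2
    omega
  have hV' : ∀ i : ℕ, evalSP v ((i : ℤ) + 1) = V (i + 1) := fun i => by
    rw [← hV]; push_cast; rfl
  have hfirst := h.first_valley_iff hr hd hinj'
  have hlabel := h.first_label hr hd
  rw [hr.valleyLabD_iff hd hs hw1 hw hβ hsgn, hr.valleyLabD_iff hd hs hw1 hw hβ hsgn,
    hr.valleyLabPMD_iff hd hs hw1 hw hβ]
  refine ⟨⟨?_, ?_⟩, ?_, ?_⟩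
  · rintro ⟨i, h1, h2, rfl, rfl⟩
    obtain ⟨h3, h4, h5⟩ := (hrise i).1 h1
    have h6 : ¬ (i = 1 ∧ ν 1 = 0) := by
      rintro ⟨rfl, h6⟩
      exact h2 ⟨rfl, hNN.2 ⟨h6, by rw [h5, h6]; norm_num⟩⟩
    obtain ⟨h7, h8⟩ := hlab i h3 h4 h5
    rw [hV, hV', ← h7 h6, ← h8]
    rcases le_or_gt (ν i) 0 with h9 | h9
    · have h10 := (h.adjIn_zword (l := l) (l (i + 1)) (l i)).2 ⟨i, h3, h4, h5, Or.inl ⟨h9, rfl, rfl⟩⟩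
      refine Or.inl ⟨h10, ?_⟩
      rintro ⟨h11, h12⟩
      obtain ⟨h13, -, -⟩ := (hfirst (l (i + 1))).1 ⟨by rwa [← h11], h12⟩
      exact h6 ⟨hinj' i 1 h3 h4.le le_rfl (by omega) (by rw [h11, hlabel h13]), h13⟩
    · have h10 := (h.adjIn_zword (l := l) (-l i) (-l (i + 1))).2
        ⟨i, h3, h4, h5, Or.inr ⟨h9, rfl, rfl⟩⟩
      refine Or.inr ⟨h10, ?_⟩
      rintro ⟨h11, h12⟩
      obtain ⟨h13, -, -⟩ := (hfirst (-l i)).1 ⟨by rwa [← h11], h12⟩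
      have := hinj' (i + 1) 1 (by omega) (by omega) le_rfl (by omega)
        (by rw [← hlabel h13, ← h11, abs_neg])
      omega
  · rintro (⟨h1, h2⟩ | ⟨h1, h2⟩)
    · obtain ⟨i, h3, h4, h5, (⟨h6, h7, h8⟩ | ⟨h6, h7, h8⟩)⟩ := (h.adjIn_zword b a).1 h1
      · obtain ⟨h9, h10⟩ := hlab i h3 h4 h5
        have h11 : ¬ (i = 1 ∧ ν 1 = 0) := by
          rintro ⟨rfl, h11⟩
          have h12 := (hfirst b).2 ⟨h11, by rw [h5, h11]; norm_num, h7⟩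
          exact h2 ⟨by rw [h8, hlabel h11], h12.2⟩
        refine ⟨i, (hrise i).2 ⟨h3, h4, h5⟩, fun h12 => h11 ⟨h12.1, (hNN.1 h12.2).1⟩, ?_, ?_⟩
        · rw [hV, h8, h9 h11]
        · rw [hV', h7, h10]
      · rw [(hlab i h3 h4 h5).1 (by rintro ⟨rfl, h9⟩; omega)] at h7
        exact absurd h7 (hsign hb i h3 h4.le)
    · obtain ⟨i, h3, h4, h5, (⟨h6, h7, h8⟩ | ⟨h6, h7, h8⟩)⟩ := (h.adjIn_zword (-a) (-b)).1 h1
      · rw [(hlab i h3 h4 h5).2] at h7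
        exact absurd (neg_eq_iff_eq_neg.1 h7) (hsign ha (i + 1) (by omega) h4)
      · have h11 : ¬ (i = 1 ∧ ν 1 = 0) := by rintro ⟨rfl, h9⟩; omega
        obtain ⟨h9, h10⟩ := hlab i h3 h4 h5
        refine ⟨i, (hrise i).2 ⟨h3, h4, h5⟩, fun h12 => h11 ⟨h12.1, (hNN.1 h12.2).1⟩, ?_, ?_⟩
        · rw [hV, ← h9 h11, neg_inj.1 h7]
        · rw [hV', ← h10, neg_inj.1 h8]
  · rintro ⟨h1, h2, h3, rfl⟩
    obtain ⟨h4, h5⟩ := hNN.1 h2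
    have h6 := (hlab 1 le_rfl (by omega) (by rw [h4, h5]; norm_num)).2
    have h7 : evalSP v 2 = l 2 := by rw [h6]; exact_mod_cast hV 2
    obtain ⟨h8, h9⟩ := (hfirst _).2 ⟨h4, h5, h7⟩
    refine ⟨h8, h9, ?_⟩
    rw [h3, hlabel h4, habs 1 le_rfl (by omega)]
    congr 1
    exact_mod_cast hV 1
  · rintro ⟨h1, h2, h3⟩
    obtain ⟨h4, h5, rfl⟩ := (hfirst b).1 ⟨h1, h2⟩
    have h6 : ν (1 + 1) = ν 1 - 1 := by rw [h4]; simpa using h5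
    refine ⟨(hrise 1).2 ⟨le_rfl, by omega, h6⟩, hNN.2 ⟨h4, h5⟩, ?_, ?_⟩
    · rw [h3, hlabel h4, habs 1 le_rfl (by omega)]
      congr 1
      exact_mod_cast (hV 1).symm
    · rw [(hlab 1 le_rfl (by omega) h6).2]
      exact_mod_cast (hV 2).symm

/-! ### Lattice paths -/

theorem isRise_E (π : List Step) (i : ℕ) : IsRise (Step.E :: π) i ↔ IsRise π i := by
  constructor
  · rintro ⟨p, h1, h2, h3⟩
    cases p with
    | zero => simp at h1
    | succ p => exact ⟨p, by simpa using h1, by simpa using h2, by simpa using h3⟩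
  · rintro ⟨p, h1, h2, h3⟩
    exact ⟨p + 1, by simpa using h1, by simpa using h2, by simpa using h3⟩

theorem isRise_N (π : List Step) (i : ℕ) :
    IsRise (Step.N :: π) i ↔ (i = 1 ∧ π.head? = some Step.N) ∨ ∃ k, i = k + 1 ∧ IsRise π k := by
  constructor
  · rintro ⟨p, h1, h2, h3⟩
    cases p with
    | zero => exact Or.inl ⟨by simpa using h3.symm, by simpa [List.head?_eq_getElem?] using h2⟩
    | succ p =>
      exact Or.inr ⟨i - 1, by simp at h3; omega, p, by simpa using h1, by simpa using h2,
        by simp at h3; omega⟩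
  · rintro (⟨rfl, h⟩ | ⟨k, rfl, p, h1, h2, h3⟩)
    · exact ⟨0, by simp, by simpa [List.head?_eq_getElem?] using h, by simp⟩
    · exact ⟨p + 1, by simpa using h1, by simpa using h2, by simpa using h3⟩

theorem ebn_le_count (π : List Step) (k : ℕ) : ebn π k ≤ π.count Step.E := by
  induction π generalizing k with
  | nil => cases k <;> simp [ebn]
  | cons s π ih =>
    cases k with
    | zero => simp [ebn]
    | succ k =>
      cases s with
      | N => simpa [ebn] using ih k
      | E => simpa [ebn] using ih (k + 1)

theorem ebn_one_eq_zero_iff (π : List Step) (h : 1 ≤ π.count Step.N) :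
    ebn π 1 = 0 ↔ π.head? = some Step.N := by
  cases π with
  | nil => simp at h
  | cons s π => cases s <;> simp [ebn]

theorem ebn_le_succ (π : List Step) (k : ℕ) (hk : k < π.count Step.N) :
    ebn π k ≤ ebn π (k + 1) := by
  induction π generalizing k with
  | nil => simp at hk
  | cons s π ih =>
    cases k with
    | zero => simp [ebn]
    | succ k =>
      cases s with
      | N => simpa [ebn] using ih k (by simpa using hk)
      | E => simpa [ebn] using ih (k + 1) (by simpa using hk)

theorem isRise_iff (π : List Step) (i : ℕ) :
    IsRise π i ↔ 1 ≤ i ∧ i < π.count Step.N ∧ ebn π i = ebn π (i + 1) := by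
  induction π generalizing i with
  | nil => simp [IsRise]
  | cons s π ih =>
    cases s with
    | E =>
      rw [isRise_E, ih]
      cases i with
      | zero => simp
      | succ i => simp [ebn]
    | N =>
      rw [isRise_N]
      rcases i with _ | _ | i
      · simp
      · simp only [ih, ebn]
        simp only [zero_add, List.count_cons_self, true_and, le_refl]
        constructor
        · rintro (h | ⟨k, h1, h2, -⟩)
          · have h1 : 1 ≤ π.count Step.N := by
              cases π with
              | nil => simp at h
              | cons s π => simp at h; simp [h]
            exact ⟨by omega, ((ebn_one_eq_zero_iff π h1).2 h).symm⟩
          · omega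
        · rintro ⟨h1, h2⟩
          exact Or.inl ((ebn_one_eq_zero_iff π (by omega)).1 h2.symm)
      · simp only [ih, ebn, List.count_cons_self]
        constructor
        · rintro (⟨h, -⟩ | ⟨k, h1, h2, h3, h4⟩)
          · omega
          · obtain rfl : k = i + 1 := by omega
            exact ⟨by omega, by omega, h4⟩
        · rintro ⟨h1, h2, h3⟩
          exact Or.inr ⟨i + 1, rfl, by omega, by omega, h3⟩

theorem take_two_iff (π : List Step) (h : 2 ≤ π.count Step.N) :
    π.take 2 = [Step.N, Step.N] ↔ ebn π 1 = 0 ∧ ebn π 2 = 0 := by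
  rcases π with _ | ⟨_ | _, π⟩
  · simp at h
  · simp only [List.count_cons_self] at h
    rcases π with _ | ⟨_ | _, π⟩ <;> simp [ebn] at h ⊢
  · simp [ebn]

/-! ### Signs of the first and the last entry -/

theorem zeros_cons_of_ne {m : ℤ} (hm : m ≠ 0) (l : ℤ) (A : List (ℤ × ℤ)) :
    zeros ((m, l) :: A) = zeros A := by
  simp [zeros, hm]

theorem IsNormal.isReading {n : ℕ} {ν l μ u : ℕ → ℤ} (h : IsNormal n ν) (hn : 1 - ν n < (2 * n : ℕ))
    (h1 : (μ 1 = ν 1 ∧ u 1 = l 1) ∨ (ν 1 ≠ 0 ∧ μ 1 = -ν 1 ∧ u 1 = -l 1))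
    (hmid : ∀ i, 1 < i → i < n → μ i = ν i ∧ u i = l i)
    (hlast : (μ n = ν n ∧ u n = l n) ∨ (μ n = 1 - ν n ∧ u n = -l n))
    (hinj : ∀ i j, 1 ≤ i → i ≤ n → 1 ≤ j → j ≤ n → |l i| = |l j| → i = j)
    (hne : ∀ i, 1 ≤ i → i ≤ n → l i ≠ 0) :
    IsReading n (zword (arr n ν l) (2 * n)) (diag (arr n μ u) (2 * n)) (zeros (arr n ν l))
      ((zword (arr n μ u) (2 * n)).map Prod.fst).dropLast := by
  have h2 := h.two_le
  set ν' : ℕ → ℤ := fun i => if i = n then ν n else μ i with hν'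
  set u' : ℕ → ℤ := fun i => if i = n then l n else u i with hu'
  have hν'n : ν' n = ν n := by simp [hν']
  have hu'n : u' n = l n := by simp [hu']
  have hν1 : ν' 1 = μ 1 := if_neg (by omega)
  have hu1 : u' 1 = u 1 := if_neg (by omega)
  have hentry : ∀ i, 1 ≤ i → i ≤ n → |ν' i| = |ν i| ∧ |u' i| = |l i| := by
    intro i hi hin
    rcases hin.eq_or_lt with rfl | hin
    · rw [hν'n, hu'n]; exact ⟨rfl, rfl⟩
    rcases hi.eq_or_lt with rfl | hi
    · rw [hν1, hu1]
      rcases h1 with ⟨h3, h4⟩ | ⟨-, h3, h4⟩ <;> rw [h3, h4] <;> simp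
    · obtain ⟨h3, h4⟩ := hmid i hi hin
      simp only [hν', hu', if_neg hin.ne, h3, h4, and_self]
  have hmid' : ∀ m, n = m + 2 → ∀ (f g f' g' : ℕ → ℤ),
      (∀ i, 1 < i → i < n → f i = f' i ∧ g i = g' i) →
      (List.range m).map (fun k => (f (k + 2), g (k + 2))) =
        (List.range m).map (fun k => (f' (k + 2), g' (k + 2))) := by
    intro m hm f g f' g' hf
    refine List.map_congr_left fun k hk => ?_
    have := List.mem_range.1 hk
    obtain ⟨h3, h4⟩ := hf (k + 2) (by omega) (by omega)
    rw [h3, h4]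
  have hA' : arr n ν' u' = arr n ν l ∨ ∃ m a B, m ≠ 0 ∧ arr n ν' u' = (-m, -a) :: B ∧
      arr n ν l = (m, a) :: B := by
    obtain ⟨m, rfl⟩ := Nat.exists_eq_add_of_le' h2
    rw [arr_add_two, arr_add_two, hν'n, hu'n, hν1, hu1,
      hmid' m rfl ν' u' ν l fun i hi hin => by
        simpa only [hν', hu', if_neg hin.ne] using hmid i hi hin]
    rcases h1 with ⟨h3, h4⟩ | ⟨h0, h3, h4⟩
    · exact Or.inl (by rw [h3, h4])
    · exact Or.inr ⟨_, _, _, h0, by rw [h3, h4]; rfl, rfl⟩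
  have hrefl : diag (arr n μ u) (2 * n) = diag (arr n ν' u') (2 * n) ∧
      ((zword (arr n μ u) (2 * n)).map Prod.fst).dropLast =
        ((zword (arr n ν' u') (2 * n)).map Prod.fst).dropLast := by
    obtain ⟨m, rfl⟩ := Nat.exists_eq_add_of_le' h2
    rw [arr_add_two, arr_add_two, hν'n, hu'n, hν1, hu1,
      hmid' m rfl ν' u' μ u fun i hi hin => by simp only [hν', hu', if_neg hin.ne, and_self]]
    rcases hlast with ⟨h3, h4⟩ | ⟨h3, h4⟩
    · rw [h3, h4]; exact ⟨rfl, rfl⟩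
    · have hl := h.last
      rw [h3, h4]
      refine ⟨diag_reflect_last _ _ _ _, ?_⟩
      rw [← zword_reflect_last _ (by omega) _ (by exact_mod_cast hn)]
      simp
  have hlen : (arr n ν' u').length = n := by simp [arr]
  have hzeros : zeros (arr n ν' u') = zeros (arr n ν l) := by
    rcases hA' with hA' | ⟨m, a, B, h0, h3, h4⟩
    · rw [hA']
    · rw [h3, h4, zeros_cons_of_ne h0, zeros_cons_of_ne (neg_ne_zero.2 h0)]
  have hzword : zword (arr n ν' u') (2 * n) = zword (arr n ν l) (2 * n) := by
    rcases hA' with hA' | ⟨m, a, B, h0, h3, h4⟩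
    · rw [hA']
    · rw [h3, h4, zword_neg_head h0]
  have key := isReading_of_array (A := arr n ν l) (A' := arr n ν' u') (K := 2 * n) h.slow_arr
    h.head_nonneg h.last_nonpos (by omega) ?_ hzeros hzword h.arr_ne_nil ?_ ?_ rfl
  · rwa [hlen, ← hrefl.1, ← hzword, ← hrefl.2, hzword] at key
  · intro p hp
    obtain ⟨k, hk, rfl⟩ := List.mem_map.1 hp
    have hk' := List.mem_range.1 hk
    rw [(hentry (k + 1) (by omega) hk').1]
    exact h.bound _ (by omega) hk'
  · rw [arr, List.map_map]
    refine List.Nodup.map_on ?_ List.nodup_range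
    intro i hi j hj hij
    rw [List.mem_range] at hi hj
    simp only [Function.comp] at hij
    rw [(hentry (i + 1) (by omega) hi).2, (hentry (j + 1) (by omega) hj).2] at hij
    have := hinj (i + 1) (j + 1) (by omega) hi (by omega) hj hij
    omega
  · intro p hp
    obtain ⟨k, hk, rfl⟩ := List.mem_map.1 hp
    have hk' := List.mem_range.1 hk
    have := (hentry (k + 1) (by omega) hk').2
    rw [← abs_pos, this, abs_pos]
    exact hne _ (by omega) hk'

/-! ### The area vector -/

/-- The sign by which the first entry of the area vector differs from the number of initial East
steps. -/
def firstSign (n : ℕ) (π : SPath) : ℤ :=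
  if (n - 1) % 4 = 0 ∨ (n - 1) % 4 = 3 then π.sgn else -π.sgn

theorem firstSign_eq {n : ℕ} {π : SPath} (h : π.sgn = 1 ∨ π.sgn = -1) :
    firstSign n π = 1 ∨ firstSign n π = -1 := by
  unfold firstSign
  split_ifs <;> omega

/-- The sign attached to an index by the diagonal reading word. -/
def labelSign (n : ℕ) (π : SPath) (j : ℕ) : ℤ :=
  (if j = n then (if (1 + areaD n π (n - 1) + areaD n π n) % 2 = 0 then 1 else -1) else 1) *
    (if j = 1 then
        π.sgn * (if (1 + ((n : ℤ) - 2) +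
            (if (n - 1) % 4 = 0 ∨ (n - 1) % 4 = 3 then (n : ℤ) - 1 else (n : ℤ))) % 2 = 0
          then 1 else -1)
      else 1)

/-- The larger candidate for the last entry of the area vector up to reflection. -/
def lastEntry (n : ℕ) (π : SPath) : ℤ :=
  2 * (ebn π.path n : ℤ) - ebn π.path (n - 1) - ((n : ℤ) - 1)

theorem areaD_one (n : ℕ) (π : SPath) : areaD n π 1 = firstSign n π * ebn π.path 1 := by
  simp only [areaD, lamD, firstSign, if_true]
  split_ifs <;> ring

theorem areaD_mid {n i : ℕ} (π : SPath) (h1 : 1 < i) (h2 : i < n) :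
    areaD n π i = ebn π.path i - ((i : ℤ) - 1) := by
  simp only [areaD, lamD, if_neg h1.ne', if_neg h2.ne]

theorem areaD_last {n : ℕ} (π : SPath) (hn : 2 ≤ n) :
    areaD n π n = lastEntry n π ∨ areaD n π n = 1 - lastEntry n π := by
  simp only [areaD, lamD, lastEntry, if_neg (show n ≠ 1 by omega), if_true]
  split_ifs <;> omega

theorem labelSign_one {n : ℕ} (π : SPath) (hn : 2 ≤ n) : labelSign n π 1 = firstSign n π := by
  simp only [labelSign, firstSign, if_neg (show 1 ≠ n by omega), if_true]
  split_ifs <;> omega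

theorem labelSign_mid {n i : ℕ} (π : SPath) (h1 : 1 < i) (h2 : i < n) : labelSign n π i = 1 := by
  simp only [labelSign, if_neg h1.ne', if_neg h2.ne, mul_one]

theorem labelSign_last {n : ℕ} {π : SPath} (hn : 2 ≤ n) (h : π.sgn = 1 ∨ π.sgn = -1) :
    (areaD n π n = lastEntry n π ∧ labelSign n π n = 1) ∨
      (areaD n π n = 1 - lastEntry n π ∧ labelSign n π n = -1) := by
  have h1 : (areaD n π (n - 1) - (ebn π.path (n - 1) - ((n : ℤ) - 2))) % 2 = 0 := by
    rcases hn.eq_or_lt with rfl | hn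
    · rw [areaD_one]
      rcases firstSign_eq (n := 2) h with h2 | h2 <;> rw [h2] <;> push_cast <;> omega
    · rw [areaD_mid π (by omega) (by omega)]
      omega
  simp only [labelSign, if_neg (show n ≠ 1 by omega), if_true, mul_one]
  rcases areaD_last π hn with h2 | h2
  · refine Or.inl ⟨h2, if_pos ?_⟩
    rw [h2]
    unfold lastEntry
    omega
  · refine Or.inr ⟨h2, if_neg ?_⟩
    rw [h2]
    unfold lastEntry
    omega

/-- The area vector in normal form. -/
def normalArea (n : ℕ) (π : SPath) (i : ℕ) : ℤ :=
  if i = n then min (lastEntry n π) (1 - lastEntry n π) else ebn π.path i - ((i : ℤ) - 1)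

/-- The labels accompanying the normal form of the area vector. -/
def normalLabel {n : ℕ} (π : SPath) (v : Fin n → ℤ) (i : ℕ) : ℤ :=
  if i = n then (if lastEntry n π ≤ 0 then evalSP v i else -evalSP v i)
  else if i = 1 ∧ ebn π.path 1 = 0 then firstSign n π * evalSP v i
  else evalSP v i

theorem normalArea_of_ne {n i : ℕ} (π : SPath) (h : i ≠ n) :
    normalArea n π i = ebn π.path i - ((i : ℤ) - 1) := if_neg h

theorem normalArea_last (n : ℕ) (π : SPath) :
    normalArea n π n = min (lastEntry n π) (1 - lastEntry n π) := if_pos rfl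

theorem abs_normalLabel {n : ℕ} {π : SPath} (v : Fin n → ℤ) (h : π.sgn = 1 ∨ π.sgn = -1) (i : ℕ) :
    |normalLabel π v i| = |evalSP v i| := by
  unfold normalLabel
  rcases firstSign_eq (n := n) h with h2 | h2 <;> rw [h2] <;> split_ifs <;> simp

section LatticePath

variable {n : ℕ} {π : SPath}

theorem ebn_last_bounds (h : IsLatticePath (n - 1) n π.path) (hn : 2 ≤ n) :
    ebn π.path (n - 1) ≤ ebn π.path n ∧ ebn π.path n ≤ n - 1 := by
  have h1 := ebn_le_succ π.path (n - 1) (by rw [h.2]; omega)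
  rw [Nat.sub_add_cancel (by omega)] at h1
  exact ⟨h1, h.1 ▸ ebn_le_count π.path n⟩

theorem isNormal_normalArea (h : IsLatticePath (n - 1) n π.path) (hn : 2 ≤ n) :
    IsNormal n (normalArea n π) where
  two_le := hn
  first := by
    rw [normalArea_of_ne π (by omega)]
    omega
  last := by
    rw [normalArea_last]
    omega
  slow := by
    intro i h1 h2
    rw [normalArea_of_ne π h2.ne]
    rcases (show i + 1 ≤ n from h2).eq_or_lt with rfl | h3
    · obtain ⟨h4, h5⟩ := ebn_last_bounds h hn
      rw [normalArea_last, lastEntry]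
      simp only [Nat.add_sub_cancel] at *
      omega
    · have := ebn_le_succ π.path i (by rw [h.2]; omega)
      rw [normalArea_of_ne π h3.ne]
      push_cast
      omega
  bound := by
    intro i h1 h2
    rcases h2.eq_or_lt with rfl | h2
    · obtain ⟨h4, h5⟩ := ebn_last_bounds h hn
      rw [normalArea_last, lastEntry, abs_lt]
      omega
    · have := ebn_le_count π.path i
      rw [h.1] at this
      rw [normalArea_of_ne π h2.ne, abs_lt]
      omega

theorem isRise_iff_normalArea (h : IsLatticePath (n - 1) n π.path) (hn : 2 ≤ n) (i : ℕ) :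
    IsRise π.path i ↔ 1 ≤ i ∧ i < n ∧ normalArea n π (i + 1) = normalArea n π i - 1 := by
  rw [isRise_iff, h.2]
  refine and_congr_right fun h1 => and_congr_right fun h2 => ?_
  rw [normalArea_of_ne π h2.ne]
  rcases (show i + 1 ≤ n from h2).eq_or_lt with rfl | h3
  · obtain ⟨h4, h5⟩ := ebn_last_bounds h hn
    rw [normalArea_last, lastEntry]
    simp only [Nat.add_sub_cancel] at *
    omega
  · rw [normalArea_of_ne π h3.ne]
    push_cast
    omega

theorem take_two_iff_normalArea (h : IsLatticePath (n - 1) n π.path) (hn : 2 ≤ n) :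
    π.path.take 2 = [Step.N, Step.N] ↔ normalArea n π 1 = 0 ∧ normalArea n π 2 = -1 := by
  have h1 : IsRise π.path 1 ↔ ebn π.path 1 = ebn π.path 2 := by
    rw [isRise_iff, h.2]
    simp
    omega
  rw [take_two_iff π.path (by rw [h.2]; exact hn)]
  have h2 := isRise_iff_normalArea h hn 1
  have h3 : normalArea n π 1 = ebn π.path 1 := by
    rw [normalArea_of_ne π (by omega)]
    simp
  rw [h1, h3] at h2
  rw [h3]
  simp only [le_refl, true_and, one_add_one_eq_two] at h2
  omega

theorem normalLabel_of_rise (h : IsLatticePath (n - 1) n π.path) (hn : 2 ≤ n) (v : Fin n → ℤ)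
    {i : ℕ} (h1 : 1 ≤ i) (h2 : i < n) (h3 : normalArea n π (i + 1) = normalArea n π i - 1) :
    (¬ (i = 1 ∧ normalArea n π 1 = 0) → normalLabel π v i = evalSP v i) ∧
      normalLabel π v (i + 1) = evalSP v ((i + 1 : ℕ) : ℤ) := by
  constructor
  · intro h4
    rw [normalArea_of_ne π (by omega)] at h4
    rw [normalLabel, if_neg h2.ne, if_neg]
    rintro ⟨rfl, h5⟩
    exact h4 ⟨rfl, by simp [h5]⟩
  · rcases (show i + 1 ≤ n from h2).eq_or_lt with rfl | h5
    · rw [normalLabel, if_pos rfl, if_pos]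
      obtain ⟨h6, h7⟩ := ebn_last_bounds h hn
      rw [normalArea_last, normalArea_of_ne π h2.ne, lastEntry] at h3
      rw [lastEntry]
      simp only [Nat.add_sub_cancel] at *
      omega
    · rw [normalLabel, if_neg h5.ne, if_neg (by omega)]

end LatticePath

/-! ### Matching the definitions -/

theorem evalSP_succ {n : ℕ} (w : Fin n → ℤ) {k : ℕ} (hk : k < n) :
    evalSP w ((k + 1 : ℕ) : ℤ) = w ⟨k, hk⟩ := by
  rw [evalSP, dif_pos (by omega)]
  congr 2
  omega

theorem arr_map_fst (n : ℕ) (π : SPath) (u : ℕ → ℤ) :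
    (arr n (areaD n π) u).map Prod.fst = areaDList n π := by
  simp [arr, areaDList, Function.comp_def]

theorem map_fst_read_dbl (A : List (ℤ × ℤ)) (j : ℤ) :
    (read j (dbl A)).map Prod.fst = sMinusR j (A.map Prod.fst) ++ sPlusL j (A.map Prod.fst) := by
  rw [read, dbl, List.filterMap_append, List.map_append, sMinusR, sMinusL, sPlusL, ← List.map_reverse,
    ← List.map_reverse]
  simp only [List.filterMap_map, List.map_filterMap]
  congr 1 <;>
  · refine List.filterMap_congr fun p _ => ?_
    simp only [Function.comp]
    split_ifs <;> first | omega | rfl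

theorem map_fst_zword (A : List (ℤ × ℤ)) (K : ℕ) :
    (zword A K).map Prod.fst = (List.range K).reverse.flatMap fun j : ℕ =>
      sMinusR (j : ℤ) (A.map Prod.fst) ++ sPlusL (j : ℤ) (A.map Prod.fst) := by
  induction K with
  | zero => rfl
  | succ K ih => simp [zword, List.range_succ, ih, map_fst_read_dbl]

theorem do_pure_natCast (L : List ℕ) :
    (do let a ← L; pure (a : ℤ)) = L.map fun a : ℕ => (a : ℤ) := by
  rw [bind_pure_comp, List.map_eq_map]

theorem zetaDraw_eq (n : ℕ) (π : SPath) (u : ℕ → ℤ) :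
    zetaDraw n π = ((zword (arr n (areaD n π) u) (2 * n)).map Prod.fst).dropLast := by
  rw [map_fst_zword, arr_map_fst, zetaDraw]
  rw [do_pure_natCast, List.map_map, List.flatMap]
  rfl

theorem arr_eq_map_finRange {n : ℕ} (π : SPath) (v : Fin n → ℤ) :
    arr n (areaD n π) (fun k => labelSign n π k * evalSP v k) =
      (List.finRange n).map fun j =>
        (areaD n π (j.val + 1), labelSign n π (j.val + 1) * v j) := by
  refine List.ext_getElem (by simp [arr]) fun k h1 h2 => ?_
  have hk : k < n := by simpa [arr] using h1
  simp only [arr, List.getElem_map, List.getElem_range, List.getElem_finRange, evalSP_succ v hk]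
  rfl

/-- The sign `(-1)^#{r | 0 < μ r}` for the area vector `μ`. -/
def positiveSign (n : ℕ) (π : SPath) : ℤ :=
  if ((Finset.Icc 1 n).filter (fun r => 0 < areaD n π r)).card % 2 = 0 then 1 else -1

theorem dDList_eq {n : ℕ} (π : SPath) (v : Fin n → ℤ) {d₀ : ℤ} {d : List ℤ}
    (h : diag (arr n (areaD n π) (fun k => labelSign n π k * evalSP v k)) (4 * n + 4) = d₀ :: d) :
    dDList n π v = positiveSign n π * d₀ :: d := by
  have h1 : dDList n π v = if ((Finset.Icc 1 n).filter (fun r => 0 < areaD n π r)).card % 2 = 1 then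
      (match d₀ :: d with
        | [] => ([] : List ℤ)
        | x :: rest => -x :: rest)
      else d₀ :: d := by
    rw [← h, arr_eq_map_finRange, diag]
    simp only [← List.map_reverse, List.filterMap_map]
    rw [dDList, do_pure_natCast, List.map_map, List.flatMap]
    rfl
  rw [h1, positiveSign]
  split_ifs <;> first | omega | simp

end RiseValley

open RiseValley
/-- Rises of `(π,v) ∈ Vert(Dₙ)` labelled `(a,b)` correspond to valleys
of `(ζ_D(π), d_D(π,v))` labelled `(b,a)` or `(-a,-b)`; rises labelled `(±|a|, b)`
correspond to valleys labelled `(b, ±|a|)`. -/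
theorem riseValleyD (n : ℕ) (hn : 2 ≤ n) (π : SPath) (v : Fin n → ℤ)
    (hmem : (π, v) ∈ VertD n) (a b : ℤ) (ha : ∃ i, v i = a) (hb : ∃ i, v i = b) :
    (RiseLabD n π v a b ↔
      (ValleyLabD n (zetaD n π) (dD n π v) b a ∨
        ValleyLabD n (zetaD n π) (dD n π v) (-a) (-b))) ∧
    (RiseLabPMD n π v |a| b ↔ ValleyLabPMD n (zetaD n π) (dD n π v) b |a|) := by
  obtain ⟨hπ, ⟨hv, hvinj⟩, -⟩ := hmem
  obtain ⟨hpath, hsgn, -⟩ := hπ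
  simp only at hpath hsgn hv hvinj
  have hinj : ∀ i j, 1 ≤ i → i ≤ n → 1 ≤ j → j ≤ n →
      |evalSP v (i : ℕ)| = |evalSP v (j : ℕ)| → i = j := by
    intro i j h1 h2 h3 h4 h5
    obtain ⟨i, rfl⟩ := Nat.exists_eq_add_of_le' h1
    obtain ⟨j, rfl⟩ := Nat.exists_eq_add_of_le' h3
    rw [evalSP_succ v h2, evalSP_succ v h4] at h5
    have := congrArg Fin.val (hvinj h5)
    simp only at this
    omega
  have hne : ∀ i : ℕ, 1 ≤ i → i ≤ n → evalSP v i ≠ 0 := by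
    intro i h1 h2
    obtain ⟨i, rfl⟩ := Nat.exists_eq_add_of_le' h1
    rw [evalSP_succ v h2, ← abs_pos]
    have := (hv ⟨i, h2⟩).1
    omega
  have habs := abs_normalLabel v hsgn
  have hnorm := isNormal_normalArea hpath hn
  have hbounds := ebn_last_bounds hpath hn
  have hlast : 1 - normalArea n π n < (2 * n : ℕ) := by
    rw [normalArea_last, lastEntry]
    omega
  have hlast' := labelSign_last hn hsgn
  have hμ1 : (areaD n π 1 = normalArea n π 1 ∧
        labelSign n π 1 * evalSP v (1 : ℕ) = normalLabel π v 1) ∨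
      (normalArea n π 1 ≠ 0 ∧ areaD n π 1 = -normalArea n π 1 ∧
        labelSign n π 1 * evalSP v (1 : ℕ) = -normalLabel π v 1) := by
    rw [areaD_one, normalArea_of_ne π (by omega), labelSign_one π hn, normalLabel,
      if_neg (by omega)]
    by_cases h0 : ebn π.path 1 = 0
    · simp [h0]
    · rcases firstSign_eq (n := n) hsgn with h1 | h1 <;> simp [h0, h1]
  have hμmid : ∀ i, 1 < i → i < n → areaD n π i = normalArea n π i ∧
      labelSign n π i * evalSP v i = normalLabel π v i := by
    intro i h1 h2
    rw [areaD_mid π h1 h2, normalArea_of_ne π h2.ne, labelSign_mid π h1 h2, normalLabel,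
      if_neg h2.ne, if_neg (by omega), one_mul]
    exact ⟨rfl, rfl⟩
  have hμn : (areaD n π n = normalArea n π n ∧
        labelSign n π n * evalSP v n = normalLabel π v n) ∨
      (areaD n π n = 1 - normalArea n π n ∧
        labelSign n π n * evalSP v n = -normalLabel π v n) := by
    rw [normalArea_last, normalLabel, if_pos rfl]
    rcases le_or_gt (lastEntry n π) 0 with h1 | h1
    · rw [if_pos h1, min_eq_left (by omega)]
      rcases hlast' with ⟨h2, h3⟩ | ⟨h2, h3⟩
      · exact Or.inl ⟨h2, by rw [h3, one_mul]⟩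
      · exact Or.inr ⟨h2, by rw [h3, neg_one_mul]⟩
    · rw [if_neg h1.not_ge, min_eq_right (by omega)]
      rcases hlast' with ⟨h2, h3⟩ | ⟨h2, h3⟩
      · exact Or.inr ⟨by rw [h2]; ring, by rw [h3]; ring⟩
      · exact Or.inl ⟨h2, by rw [h3, neg_one_mul]⟩
  have hread := hnorm.isReading (l := normalLabel π v) (μ := areaD n π)
    (u := fun k => labelSign n π k * evalSP v k) hlast hμ1 hμmid hμn
    (fun i j h1 h2 h3 h4 h5 => hinj i j h1 h2 h3 h4 (by rwa [← habs, ← habs]))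
    (fun i h1 h2 h3 => hne i h1 h2 (by simpa [h3, eq_comm] using habs i))
  rw [← zetaDraw_eq] at hread
  have hbound : ∀ p ∈ arr n (areaD n π) (fun k => labelSign n π k * evalSP v k),
      |p.1| < (2 * n : ℕ) := by
    intro p hp
    obtain ⟨k, hk, rfl⟩ := List.mem_map.1 hp
    have hk' : k + 1 ≤ n := List.mem_range.1 hk
    have h1 := hnorm.bound (k + 1) (by omega) hk'
    simp only
    rcases hk'.eq_or_lt with h2 | h2
    · have h3 := hnorm.last
      rw [h2] at h1 ⊢
      rw [abs_lt] at h1 ⊢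
      omega
    rcases Nat.eq_zero_or_pos k with rfl | h3
    · rw [abs_lt] at h1 ⊢
      simp only [zero_add] at *
      omega
    · rwa [(hμmid (k + 1) (by omega) h2).1]
  rw [← diag_eq_of_le hbound (show 2 * n ≤ 4 * n + 4 by omega)] at hread
  generalize hd : diag _ (4 * n + 4) = d at hread
  obtain ⟨d₀, d, rfl⟩ : ∃ d₀ d', d = d₀ :: d' := by
    cases d with
    | nil => have := hread.length_eq; simp at this; omega
    | cons d₀ d => exact ⟨d₀, d, rfl⟩
  have hdD := dDList_eq π v hd
  have hlabel : ∀ {c : ℤ}, (∃ i, v i = c) → ∃ k : ℕ, 1 ≤ k ∧ k ≤ n ∧ evalSP v k = c := by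
    rintro c ⟨⟨i, hi⟩, rfl⟩
    exact ⟨i + 1, by omega, hi, evalSP_succ v hi⟩
  refine rise_valley_of_normal (s := positiveSign n π) hnorm hread (fun _ => rfl) hinj hne
    (fun i _ _ => habs i) (isRise_iff_normalArea hpath hn) (take_two_iff_normalArea hpath hn)
    (fun i h1 h2 h3 => normalLabel_of_rise hpath hn v h1 h2 h3) (d₀ := d₀) rfl ?_ ?_ ?_ rfl ?_ a b
    (hlabel ha) (hlabel hb)
  · unfold positiveSign
    split_ifs <;> rfl
  · have := evalSP_succ (dD n π v) (k := 0) (by omega)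
    rw [dD, hdD] at this
    exact this
  · intro k h1 h2
    have h3 := evalSP_succ (dD n π v) h2
    push_cast at h3
    have h4 : k < (d₀ :: d).length := by rw [hread.length_eq]; exact h2
    rw [h3, dD, hdD]
    obtain ⟨k, rfl⟩ := Nat.exists_eq_add_of_le' h1
    simp only [List.length_cons, add_lt_add_iff_right] at h4
    simp [h4]
  · intro h1
    rw [zetaD, if_pos h1]
    rfl
end

section
/- For every n ≥ 2, the type B_n zeta map ζ_B is a bijection from the set L_{n,n} of lattice paths with n East and n North steps onto the set B_{2n} of ballot paths of length 2n. -/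
/-- The vector `λ(π)` of type `Bₙ` (1-based index). -/
def lamB (n : ℕ) (π : List Step) (i : ℕ) : ℤ :=
  if i = n then
    (if (∑ k ∈ Finset.Icc 1 (n - 2), ebn π k) % 2 = 0 then
        2 * (ebn π n : ℤ) - (ebn π (n - 1) : ℤ)
      else 2 * (n : ℤ) + 1 - 2 * (ebn π n : ℤ) + (ebn π (n - 1) : ℤ))
  else (ebn π i : ℤ)

/-- The type `Bₙ` area vector (1-based index). -/
def areaBv (n : ℕ) (π : List Step) (i : ℕ) : ℤ :=
  if i = n then
    (if n % 4 = 0 ∨ n % 4 = 3 then lamB n π n - (n : ℤ) else (n : ℤ) + 1 - lamB n π n)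
  else lamB n π i - (i : ℤ)

def areaBList (n : ℕ) (π : List Step) : List ℤ :=
  (List.range n).map fun k => areaBv n π (k + 1)

/-- The type `Bₙ` zeta map. -/
def zetaB (n : ℕ) (π : List Step) : List Step :=
  (((List.range (2 * n)).reverse.map (fun jm =>
      sMinusR ((jm : ℤ) + 1) (areaBList n π) ++ sPlusL ((jm : ℤ) + 1) (areaBList n π))).flatten) ++
    sMinusR 0 (areaBList n π) ++ (Step.N :: sPlusL 0 (areaBList n π)).dropLast

lemma ebn_le_succ : ∀ (π : List Step) (k : ℕ), ebn π k ≤ ebn π (k + 1)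
  | [], k => by cases k <;> simp [ebn]
  | Step.E :: r, 0 => by simp [ebn]
  | Step.E :: r, k + 1 => by simpa [ebn] using ebn_le_succ r (k + 1)
  | Step.N :: r, 0 => by simp [ebn]
  | Step.N :: r, k + 1 => by simpa [ebn] using ebn_le_succ r k

lemma ebn_le_count : ∀ (π : List Step) (k : ℕ), ebn π k ≤ π.count Step.E
  | π, 0 => by simp [ebn]
  | [], k + 1 => by simp [ebn]
  | Step.E :: r, k + 1 => by simpa [ebn] using ebn_le_count r (k + 1)
  | Step.N :: r, k + 1 => by simpa [ebn] using ebn_le_count r k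

/-- A path is determined by its step counts and the numbers `ebn`. -/
lemma eq_of_ebn_eq : ∀ (π ρ : List Step), π.count Step.E = ρ.count Step.E →
    π.count Step.N = ρ.count Step.N →
    (∀ k < π.count Step.N, ebn π (k + 1) = ebn ρ (k + 1)) → π = ρ
  | [], ρ, hE, hN, _ => by
    rcases ρ with _ | ⟨s, r⟩
    · rfl
    · cases s <;> simp at hE hN
  | Step.N :: p, ρ, hE, hN, h => by
    rcases ρ with _ | ⟨_ | _, r⟩
    · simp at hN
    · rw [eq_of_ebn_eq p r (by simpa using hE) (by simpa using hN)]
      intro k hk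
      simpa [ebn] using h (k + 1) (by simpa using hk)
    · simpa [ebn] using h 0 (by simp)
  | Step.E :: p, ρ, hE, hN, h => by
    rcases ρ with _ | ⟨_ | _, r⟩
    · simp at hE
    · simpa [ebn] using h 0 (by rw [hN]; simp)
    · rw [eq_of_ebn_eq p r (by simpa using hE) (by simpa using hN)]
      intro k hk
      simpa [ebn] using h k (by simpa using hk)

/-! ### Counting ballot paths -/

/-- All words of length `m`. -/
def stepWords : ℕ → List (List Step)
  | 0 => [[]]
  | m + 1 => (stepWords m).map (Step.N :: ·) ++ (stepWords m).map (Step.E :: ·)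

lemma mem_stepWords : ∀ {m : ℕ} {w : List Step}, w ∈ stepWords m ↔ w.length = m
  | 0, w => by simp [stepWords]
  | m + 1, [] => by simp [stepWords]
  | m + 1, Step.N :: w => by simp [stepWords, mem_stepWords]
  | m + 1, Step.E :: w => by simp [stepWords, mem_stepWords]

lemma nodup_stepWords : ∀ m : ℕ, (stepWords m).Nodup
  | 0 => by simp [stepWords]
  | m + 1 => by
    have h := nodup_stepWords m
    refine List.Nodup.append (h.map fun _ _ => by simp) (h.map fun _ _ => by simp) ?_
    intro w hN hE
    simp only [List.mem_map] at hN hE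
    obtain ⟨u, -, rfl⟩ := hN
    obtain ⟨v, -, hv⟩ := hE
    simp at hv

lemma ncard_stepWords (m : ℕ) (p : List Step → Bool) :
    {w : List Step | w.length = m ∧ p w}.ncard = (stepWords m).countP p := by
  have : {w : List Step | w.length = m ∧ p w} = (((stepWords m).filter p).toFinset : Set _) := by
    ext w; simp [mem_stepWords]
  rw [this, Set.ncard_coe_finset, List.toFinset_card_of_nodup ((nodup_stepWords m).filter _),
    List.countP_eq_length_filter]

/-- Whether a path started at height `k` stays at nonnegative height. -/
def staysNonneg : ℕ → List Step → Bool
  | _, [] => true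
  | k, Step.N :: w => staysNonneg (k + 1) w
  | 0, Step.E :: _ => false
  | k + 1, Step.E :: w => staysNonneg k w

lemma staysNonneg_iff : ∀ (k : ℕ) (w : List Step), staysNonneg k w = true ↔
    ∀ i : ℕ, (w.take i).count Step.E ≤ k + (w.take i).count Step.N
  | k, [] => by simp [staysNonneg]
  | k, Step.N :: w => by
    rw [staysNonneg, staysNonneg_iff (k + 1) w]
    constructor
    · rintro h (_ | i)
      · simp
      · have := h i; simp; omega
    · intro h i
      have := h (i + 1); simp at this; omega
  | 0, Step.E :: w => by
    simp only [staysNonneg, Bool.false_eq_true, false_iff, not_forall]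
    exact ⟨1, by simp⟩
  | k + 1, Step.E :: w => by
    rw [staysNonneg, staysNonneg_iff k w]
    constructor
    · rintro h (_ | i)
      · simp
      · have := h i; simp; omega
    · intro h i
      have := h (i + 1); simp at this; omega

/-- The final height of a path started at height `z`. -/
def endHeight (z : ℤ) (w : List Step) : ℤ := z + w.count Step.N - w.count Step.E

/-- The sum of the signs of the final heights of all paths of length `m` started at `z`. -/
def signSum : ℕ → ℤ → ℤ
  | 0, z => z.sign
  | m + 1, z => signSum m (z + 1) + signSum m (z - 1)

lemma signSum_neg : ∀ (m : ℕ) (z : ℤ), signSum m (-z) = -signSum m z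
  | 0, z => by simp [signSum]
  | m + 1, z => by
    have h1 := signSum_neg m (z - 1)
    have h2 := signSum_neg m (z + 1)
    rw [show -(z - 1) = -z + 1 by ring] at h1
    rw [show -(z + 1) = -z - 1 by ring] at h2
    rw [signSum, signSum, h1, h2]
    ring

lemma signSum_zero (m : ℕ) : signSum m 0 = 0 := by
  have := signSum_neg m 0
  simp at this
  omega

lemma countP_staysNonneg : ∀ (m k : ℕ),
    (((stepWords m).countP (staysNonneg k) : ℕ) : ℤ) = signSum m (k + 1)
  | 0, k => by
    rw [signSum, Int.sign_eq_one_of_pos (by omega)]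
    simp [stepWords, staysNonneg]
  | m + 1, 0 => by
    have h := countP_staysNonneg m 1
    rw [stepWords, List.countP_append, List.countP_map, List.countP_map]
    have e1 : staysNonneg 0 ∘ (Step.N :: ·) = staysNonneg 1 := by ext; simp [staysNonneg]
    have e2 : staysNonneg 0 ∘ (Step.E :: ·) = fun _ => false := by ext; simp [staysNonneg]
    rw [e1, e2, signSum]
    push_cast at h ⊢
    simp [h, signSum_zero]
  | m + 1, k + 1 => by
    have h1 := countP_staysNonneg m (k + 2)
    have h2 := countP_staysNonneg m k
    rw [stepWords, List.countP_append, List.countP_map, List.countP_map]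
    have e1 : staysNonneg (k + 1) ∘ (Step.N :: ·) = staysNonneg (k + 2) := by
      ext; simp [staysNonneg]
    have e2 : staysNonneg (k + 1) ∘ (Step.E :: ·) = staysNonneg k := by
      ext; simp [staysNonneg]
    rw [e1, e2, signSum]
    push_cast at h1 h2 ⊢
    rw [h1, h2]
    ring_nf

lemma countP_endHeight_succ (m : ℕ) (z : ℤ) :
    (stepWords (m + 1)).countP (fun w => endHeight z w = 0) =
      (stepWords m).countP (fun w => endHeight (z + 1) w = 0) +
      (stepWords m).countP (fun w => endHeight (z - 1) w = 0) := by
  rw [stepWords, List.countP_append, List.countP_map, List.countP_map]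
  congr 2
  · ext w; simp [endHeight]; grind
  · ext w; simp [endHeight]; grind

lemma signSum_succ_sub : ∀ (m : ℕ) (z : ℤ), signSum m (z + 1) - signSum m z =
    (stepWords m).countP (fun w => endHeight z w = 0) +
    (stepWords m).countP (fun w => endHeight (z + 1) w = 0)
  | 0, z => by
    simp only [signSum, stepWords, endHeight, List.countP_singleton]
    rcases lt_trichotomy z (-1) with h | rfl | h
    · rw [Int.sign_eq_neg_one_of_neg (by omega), Int.sign_eq_neg_one_of_neg (by omega)]
      simp; grind
    · simp
    · rcases eq_or_lt_of_le (show 0 ≤ z by omega) with rfl | h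
      · simp
      · rw [Int.sign_eq_one_of_pos (by omega), Int.sign_eq_one_of_pos (by omega)]
        simp; grind
  | m + 1, z => by
    have h1 := signSum_succ_sub m (z + 1)
    have h2 := signSum_succ_sub m (z - 1)
    rw [countP_endHeight_succ, countP_endHeight_succ, signSum, signSum]
    simp only [sub_add_cancel, add_sub_cancel_right] at h1 h2 ⊢
    push_cast
    linarith

lemma count_N_add_count_E : ∀ w : List Step, w.count Step.N + w.count Step.E = w.length
  | [] => rfl
  | Step.N :: w => by have := count_N_add_count_E w; simp; omega
  | Step.E :: w => by have := count_N_add_count_E w; simp; omega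

lemma ncard_ballot_eq (n : ℕ) : {β : List Step | IsBallotPath (2 * n) β}.ncard =
    {π : List Step | IsLatticePath n n π}.ncard := by
  have h1 : {β : List Step | IsBallotPath (2 * n) β} =
      {w : List Step | w.length = 2 * n ∧ staysNonneg 0 w} := by
    ext w; simp [IsBallotPath, staysNonneg_iff]
  have h2 : {π : List Step | IsLatticePath n n π} =
      {w : List Step | w.length = 2 * n ∧ decide (endHeight 0 w = 0)} := by
    ext w
    have := count_N_add_count_E w
    rw [Set.mem_ofPred_eq, Set.mem_ofPred_eq, decide_eq_true_iff, IsLatticePath, endHeight]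
    omega
  rw [h1, h2, ncard_stepWords, ncard_stepWords]
  have h3 := countP_staysNonneg (2 * n) 0
  have h4 := signSum_succ_sub (2 * n) 0
  have h5 : (stepWords (2 * n)).countP (fun w => endHeight (0 + 1) w = 0) = 0 := by
    rw [List.countP_eq_zero]
    intro w hw
    have := count_N_add_count_E w
    rw [mem_stepWords.1 hw] at this
    rw [decide_eq_true_iff, endHeight]
    omega
  rw [signSum_zero, h5] at h4
  push_cast at h3 h4
  omega

/-! ### Level words of integer lists -/

@[simp] lemma sPlusL_nil (j : ℤ) : sPlusL j [] = [] := rfl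

lemma sPlusL_cons (j x : ℤ) (l : List ℤ) : sPlusL j (x :: l) = sPlusL j [x] ++ sPlusL j l := by
  simp only [sPlusL, List.filterMap_cons, List.filterMap_nil]
  split <;> simp

lemma sPlusL_append (j : ℤ) (l m : List ℤ) : sPlusL j (l ++ m) = sPlusL j l ++ sPlusL j m := by
  simp [sPlusL, List.filterMap_append]

lemma sPlusL_singleton (j x : ℤ) : sPlusL j [x] =
    if x = j then [Step.N] else if x = j + 1 then [Step.E] else [] := by
  simp only [sPlusL, List.filterMap_cons, List.filterMap_nil]
  split_ifs <;> rfl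

lemma count_N_sPlusL (j : ℤ) (l : List ℤ) : (sPlusL j l).count Step.N = l.count j := by
  induction l with
  | nil => rfl
  | cons x l ih =>
    rw [sPlusL_cons, List.count_append, ih, sPlusL_singleton, List.count_cons]
    split_ifs <;> grind

lemma count_E_sPlusL (j : ℤ) (l : List ℤ) : (sPlusL j l).count Step.E = l.count (j + 1) := by
  induction l with
  | nil => rfl
  | cons x l ih =>
    rw [sPlusL_cons, List.count_append, ih, sPlusL_singleton, List.count_cons]
    split_ifs <;> grind

/-- The negated reversal of an integer list. -/
def negRev (l : List ℤ) : List ℤ := (l.map (- ·)).reverse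

lemma sMinusR_eq_sPlusL_negRev (j : ℤ) (l : List ℤ) : sMinusR j l = sPlusL j (negRev l) := by
  rw [sMinusR, sMinusL, sPlusL, negRev, ← List.map_reverse, List.filterMap_map]
  congr 1
  ext x : 1
  simp only [Function.comp]
  split_ifs <;> first | rfl | omega

/-- Consecutive entries go down by at most one. -/
abbrev DescendsSlowly (l : List ℤ) : Prop := l.IsChain fun x y => x ≤ y + 1

lemma DescendsSlowly.negRev {l : List ℤ} (h : DescendsSlowly l) : DescendsSlowly (negRev l) := by
  rw [DescendsSlowly, _root_.negRev, List.isChain_reverse, List.isChain_map]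
  exact h.imp fun x y hxy => by omega

lemma head?_sPlusL_of_lt {x : ℤ} : ∀ {y : ℤ} {l : List ℤ}, DescendsSlowly (y :: l) → x < y →
    x ∈ l → (sPlusL x (y :: l)).head? = some Step.E
  | y, [], _, _, hx => by simp at hx
  | y, z :: l, h, hy, hx => by
    rw [DescendsSlowly, List.isChain_cons_cons] at h
    rw [sPlusL_cons, sPlusL_singleton, if_neg (by omega)]
    by_cases hyx : y = x + 1
    · simp [hyx]
    · rw [if_neg hyx, List.nil_append]
      refine head?_sPlusL_of_lt h.2 (by omega) ?_
      rcases List.mem_cons.1 hx with rfl | hx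
      · omega
      · exact hx

lemma not_lt_head_of_sPlusL_eq {x y : ℤ} {l m : List ℤ} (hm : DescendsSlowly (y :: m))
    (h : sPlusL x (x :: l) = sPlusL x (y :: m)) : ¬ x < y := by
  intro hxy
  have hx : x ∈ m := by
    have h1 : x ∈ y :: m := by
      rw [← List.count_pos_iff, ← count_N_sPlusL, ← h, count_N_sPlusL]
      simp
    rcases List.mem_cons.1 h1 with rfl | h1
    · omega
    · exact h1
  have h2 := head?_sPlusL_of_lt hm hxy hx
  rw [← h, sPlusL_cons, sPlusL_singleton] at h2
  simp at h2

/-- A slowly descending list is determined by its level words. -/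
lemma eq_of_sPlusL_eq : ∀ {l m : List ℤ}, DescendsSlowly l → DescendsSlowly m →
    (∀ j, sPlusL j l = sPlusL j m) → l = m
  | [], [], _, _, _ => rfl
  | [], y :: m, _, _, h => by
    have := h y
    rw [sPlusL_cons, sPlusL_singleton] at this
    simp at this
  | x :: l, [], _, _, h => by
    have := h x
    rw [sPlusL_cons, sPlusL_singleton] at this
    simp at this
  | x :: l, y :: m, hl, hm, h => by
    have h1 := not_lt_head_of_sPlusL_eq hm (h x)
    have h2 := not_lt_head_of_sPlusL_eq hl (h y).symm
    obtain rfl : x = y := by omega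
    rw [eq_of_sPlusL_eq (l := l) (m := m) hl.tail hm.tail]
    intro j
    have := h j
    rw [sPlusL_cons, sPlusL_cons j x m] at this
    exact List.append_cancel_left this

lemma mem_of_le_head : ∀ {j x : ℤ} {l : List ℤ}, DescendsSlowly (x :: l) → j ≤ x →
    (∀ z ∈ (x :: l).getLast?, z ≤ j) → j ∈ x :: l
  | j, x, [], _, hx, h => by
    have := h x (by simp)
    simp; omega
  | j, x, y :: l, hc, hx, h => by
    rw [DescendsSlowly, List.isChain_cons_cons] at hc
    by_cases hxj : x = j
    · simp [hxj]
    · refine List.mem_cons_of_mem _ (mem_of_le_head hc.2 (by omega) ?_)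
      simpa [List.getLast?_cons_cons] using h

lemma getLast?_sPlusL : ∀ {j : ℤ} {l : List ℤ}, DescendsSlowly l →
    (∀ z ∈ l.getLast?, z ≤ j) → ∀ s ∈ (sPlusL j l).getLast?, s = Step.N
  | j, [], _, _ => by simp
  | j, [x], _, h => by
    have := h x (by simp)
    rw [sPlusL_singleton, if_neg (show x ≠ j + 1 by omega)]
    split_ifs <;> simp
  | j, x :: y :: l, hc, h => by
    rw [DescendsSlowly, List.isChain_cons_cons] at hc
    have h' : ∀ z ∈ (y :: l).getLast?, z ≤ j := by simpa [List.getLast?_cons_cons] using h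
    have ih := getLast?_sPlusL hc.2 h'
    intro s hs
    rw [sPlusL_cons, List.getLast?_append] at hs
    rcases ho : (sPlusL j (y :: l)).getLast? with _ | t
    · rw [ho, sPlusL_singleton] at hs
      rw [List.getLast?_eq_none_iff] at ho
      have hj : j ∉ y :: l := by
        rw [← List.count_eq_zero, ← count_N_sPlusL, ho]
        rfl
      have hy : ¬ j ≤ y := fun hy => hj (mem_of_le_head hc.2 hy h')
      rw [if_neg (show x ≠ j + 1 by omega)] at hs
      split_ifs at hs <;> simp_all
    · rw [ho] at hs ih
      simp_all

/-! ### Concatenated level words -/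

/-- The concatenation of the level words of `l` for the levels `j + f - 1, …, j + 1, j`. -/
def levelWord (l : List ℤ) : ℤ → ℕ → List Step
  | _, 0 => []
  | j, f + 1 => levelWord l (j + 1) f ++ sPlusL j l

lemma levelWord_eq_flatten (l : List ℤ) : ∀ (j : ℤ) (f : ℕ), levelWord l j f =
    ((List.range f).reverse.map fun i : ℕ => sPlusL (j + i) l).flatten
  | j, 0 => rfl
  | j, f + 1 => by
    rw [levelWord, levelWord_eq_flatten l (j + 1) f, List.range_succ_eq_map]
    simp only [List.reverse_cons, List.map_append, List.flatten_append, ← List.map_reverse,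
      List.map_map]
    congr 1
    · congr 2
      ext i : 1
      simp only [Function.comp]
      congr 1
      push_cast
      ring
    · simp

lemma zetaB_eq_levelWord (n : ℕ) (π : List Step) : zetaB n π =
    (levelWord (negRev (areaBList n π) ++ 0 :: areaBList n π) 0 (2 * n + 1)).dropLast := by
  rw [levelWord, levelWord_eq_flatten, sPlusL_append, sPlusL_cons, sPlusL_singleton, zetaB]
  simp only [sMinusR_eq_sPlusL_negRev, if_true, List.singleton_append, List.append_assoc]
  rw [← List.append_assoc (List.flatten _), ← List.append_assoc (List.flatten _),
    List.dropLast_append_cons]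
  congr 3
  rw [bind_pure_comp, List.map_eq_map, List.map_map]
  congr 1
  ext i : 1
  rw [sPlusL_append, sPlusL_cons, sPlusL_singleton, if_neg (by omega), if_neg (by omega)]
  simp [add_comm]

lemma count_levelWord (l : List ℤ) : ∀ (j : ℤ) (f : ℕ), (∀ x ∈ l, x < j + f) →
    (levelWord l j f).count Step.N = (levelWord l j f).count Step.E + l.count j
  | j, 0, h => by
    have h0 : l.count j = 0 := List.count_eq_zero.2 fun hj => by simpa using h j hj
    rw [h0]
    rfl
  | j, f + 1, h => by
    have ih := count_levelWord l (j + 1) f fun x hx => by have := h x hx; push_cast at this; omega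
    rw [levelWord, List.count_append, List.count_append, count_N_sPlusL, count_E_sPlusL, ih]

lemma count_take_levelWord (l : List ℤ) : ∀ (j : ℤ) (f : ℕ), (∀ x ∈ l, x < j + f) → ∀ k : ℕ,
    ((levelWord l j f).take k).count Step.E ≤ ((levelWord l j f).take k).count Step.N
  | j, 0, _, k => by simp [levelWord]
  | j, f + 1, h, k => by
    have h' : ∀ x ∈ l, x < j + 1 + f := fun x hx => by
      have := h x hx; push_cast at this; omega
    have ih := count_take_levelWord l (j + 1) f h'
    rw [levelWord, List.take_append, List.count_append, List.count_append]
    rcases le_total k (levelWord l (j + 1) f).length with hk | hk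
    · rw [Nat.sub_eq_zero_of_le hk]
      simpa using ih k
    · rw [List.take_of_length_le hk, count_levelWord l (j + 1) f h']
      have := (List.take_sublist (k - (levelWord l (j + 1) f).length) (sPlusL j l)).count_le Step.E
      rw [count_E_sPlusL] at this
      omega

lemma length_levelWord (l : List ℤ) : ∀ (j : ℤ) (f : ℕ), (∀ x ∈ l, x < j + f) →
    (levelWord l j f).length = l.countP (fun x => j ≤ x) + l.countP (fun x => j + 1 ≤ x)
  | j, 0, h => by
    rw [List.countP_eq_zero.2 fun x hx => ?_, List.countP_eq_zero.2 fun x hx => ?_]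
    · rfl
    all_goals
      have := h x hx
      simp at this ⊢
      omega
  | j, f + 1, h => by
    have ih := length_levelWord l (j + 1) f fun x hx => by have := h x hx; push_cast at this; omega
    have hc : ∀ (m : List ℤ) (i : ℤ),
        m.countP (fun x => i ≤ x) = m.countP (fun x => i + 1 ≤ x) + m.count i := by
      intro m i
      induction m with
      | nil => rfl
      | cons x m ihm =>
        simp only [List.countP_cons, List.count_cons, ihm, decide_eq_true_iff, beq_iff_eq]
        split_ifs <;> omega
    rw [levelWord, List.length_append, ih, ← count_N_add_count_E, count_N_sPlusL, count_E_sPlusL,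
      hc l j, hc l (j + 1)]
    omega

lemma getLast?_levelWord {l : List ℤ} (hl : DescendsSlowly l) (h0 : ∀ z ∈ l.getLast?, z ≤ 0) :
    ∀ (j : ℤ) (f : ℕ), 0 ≤ j → ∀ s ∈ (levelWord l j f).getLast?, s = Step.N
  | j, 0, _ => by simp [levelWord]
  | j, f + 1, hj => by
    have ih := getLast?_levelWord hl h0 (j + 1) f (by omega)
    have h1 := getLast?_sPlusL hl fun z hz => (h0 z hz).trans hj
    intro s hs
    rw [levelWord, List.getLast?_append] at hs
    rcases ho : (sPlusL j l).getLast? with _ | t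
    · rw [ho] at hs
      exact ih s (by simpa using hs)
    · rw [ho] at hs h1
      exact h1 s (by simpa using hs)

lemma append_eq_append_of_count_N {P P' S S' : List Step} (hP : ∀ s ∈ P.getLast?, s = Step.N)
    (hP' : ∀ s ∈ P'.getLast?, s = Step.N) (h : P ++ S = P' ++ S')
    (hc : S.count Step.N = S'.count Step.N) : P = P' ∧ S = S' := by
  have key : ∀ {Q T U : List Step}, (∀ s ∈ (Q ++ T).getLast?, s = Step.N) →
      (T ++ U).count Step.N = U.count Step.N → T = [] := by
    intro Q T U h1 h2
    rcases List.eq_nil_or_concat T with rfl | ⟨T, s, rfl⟩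
    · rfl
    · have := h1 s (by simp)
      subst this
      simp at h2
      omega
  rcases List.append_eq_append_iff.1 h with ⟨T, rfl, rfl⟩ | ⟨T, rfl, rfl⟩
  · obtain rfl := key hP' hc
    simp
  · obtain rfl := key hP hc.symm
    simp

lemma sPlusL_eq_of_levelWord_eq {l m : List ℤ} (hl : DescendsSlowly l) (hm : DescendsSlowly m)
    (hl0 : ∀ z ∈ l.getLast?, z ≤ 0) (hm0 : ∀ z ∈ m.getLast?, z ≤ 0) :
    ∀ (j : ℤ) (f : ℕ), 0 ≤ j → l.count j = m.count j → levelWord l j f = levelWord m j f →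
    ∀ i, j ≤ i → i < j + f → sPlusL i l = sPlusL i m
  | j, 0, _, _, _, i, h1, h2 => by simp at h2; omega
  | j, f + 1, hj, hc, h, i, h1, h2 => by
    rw [levelWord, levelWord] at h
    obtain ⟨hw, hs⟩ := append_eq_append_of_count_N
      (getLast?_levelWord hl hl0 (j + 1) f (by omega))
      (getLast?_levelWord hm hm0 (j + 1) f (by omega)) h (by simpa [count_N_sPlusL] using hc)
    rcases eq_or_lt_of_le h1 with rfl | h1
    · exact hs
    · refine sPlusL_eq_of_levelWord_eq hl hm hl0 hm0 (j + 1) f (by omega) ?_ hw i (by omega)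
        (by push_cast at h2; omega)
      rw [← count_E_sPlusL, ← count_E_sPlusL, hs]

/-! ### The antisymmetric extension of a list -/

/-- The antisymmetric extension `(-aₙ, …, -a₁, 0, a₁, …, aₙ)` of `(a₁, …, aₙ)`. -/
def centered (l : List ℤ) : List ℤ := negRev l ++ 0 :: l

lemma negRev_append (l m : List ℤ) : negRev (l ++ m) = negRev m ++ negRev l := by
  simp [negRev]

lemma negRev_cons (x : ℤ) (l : List ℤ) : negRev (x :: l) = negRev l ++ [-x] := by
  simp [negRev]

lemma negRev_negRev (l : List ℤ) : negRev (negRev l) = l := by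
  simp [negRev]

lemma negRev_centered (l : List ℤ) : negRev (centered l) = centered l := by
  rw [centered, negRev_append, negRev_cons, negRev_negRev]
  simp

lemma centered_append_singleton (l : List ℤ) (x : ℤ) :
    centered (l ++ [x]) = -x :: (centered l ++ [x]) := by
  rw [centered, negRev_append, centered]
  simp [negRev]

/-- Exchange of the two kinds of steps. -/
def Step.swap : Step → Step
  | Step.N => Step.E
  | Step.E => Step.N

lemma sPlusL_negRev (j : ℤ) (l : List ℤ) :
    sPlusL j (negRev l) = (sPlusL (-j - 1) l).reverse.map Step.swap := by
  induction l with
  | nil => rfl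
  | cons x l ih =>
    rw [negRev_cons, sPlusL_append, ih, sPlusL_cons _ x l, List.reverse_append, List.map_append]
    congr 1
    rw [sPlusL_singleton, sPlusL_singleton]
    split_ifs <;> first | rfl | omega

lemma sPlusL_eq_nil {j : ℤ} {l : List ℤ} (h : ∀ x ∈ l, x < j) : sPlusL j l = [] := by
  rw [sPlusL, List.filterMap_eq_nil_iff]
  intro x hx
  have := h x hx
  rw [if_neg (by omega), if_neg (by omega)]

lemma levelWord_cons_append_singleton (l : List ℤ) {k : ℤ} (hk : 1 ≤ k) : ∀ (j : ℤ) (f : ℕ),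
    0 ≤ j → k < j + f →
    levelWord (-k :: (l ++ [k])) j f = levelWord ((k - 1) :: l) j f ++ sPlusL j [k]
  | j, 0, _, h => by
    rw [sPlusL_eq_nil (by simpa using h)]
    rfl
  | j, f + 1, hj, h => by
    have h1 : sPlusL j [-k] = [] := by
      rw [sPlusL_singleton, if_neg (by omega), if_neg (by omega)]
    have h2 : sPlusL (j + 1) [k] = sPlusL j [k - 1] := by
      rw [sPlusL_singleton, sPlusL_singleton]
      split_ifs <;> first | rfl | omega
    rw [levelWord, levelWord_cons_append_singleton l hk (j + 1) f (by omega)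
      (by push_cast at h; omega), levelWord, sPlusL_cons j (-k), h1, sPlusL_append, h2,
      sPlusL_cons j (k - 1) l]
    simp

lemma levelWord_append_singleton_of_neg (l : List ℤ) {x : ℤ} : ∀ (j : ℤ) (f : ℕ), x < j →
    levelWord (l ++ [x]) j f = levelWord l j f
  | j, 0, _ => rfl
  | j, f + 1, h => by
    rw [levelWord, levelWord_append_singleton_of_neg l (j + 1) f (by omega), levelWord,
      sPlusL_append, sPlusL_eq_nil (l := [x]) (by simpa using h), List.append_nil]

/-- Up to its last letter the word of a vector does not change when the last entry `k` is
replaced by `1 - k`. -/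
lemma dropLast_levelWord_centered (l : List ℤ) {k : ℤ} (hk : 1 ≤ k) (f : ℕ) (hf : k < f) :
    (levelWord (centered (l ++ [k])) 0 f).dropLast =
      (levelWord (centered (l ++ [1 - k])) 0 f).dropLast := by
  rw [centered_append_singleton, centered_append_singleton,
    levelWord_cons_append_singleton _ hk 0 f le_rfl (by omega), neg_sub, ← List.cons_append]
  rcases eq_or_lt_of_le hk with rfl | hk
  · obtain ⟨f, rfl⟩ : ∃ g, f = g + 1 := ⟨f - 1, by omega⟩
    rw [levelWord, levelWord, levelWord_append_singleton_of_neg _ (0 + 1) f (by omega),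
      sPlusL_append]
    simp [sPlusL_singleton, -List.append_assoc]
  · rw [levelWord_append_singleton_of_neg _ 0 f (by omega), sPlusL_singleton,
      if_neg (by omega), if_neg (by omega), List.append_nil]

/-- Vectors of length `n` for which the central part of the zeta word can be decoded. -/
structure IsDescending (n : ℕ) (l : List ℤ) : Prop where
  length_eq : l.length = n
  descendsSlowly : DescendsSlowly (0 :: l)
  last_nonpos : ∀ z ∈ (0 :: l).getLast?, z ≤ 0
  abs_entry_le : ∀ x ∈ l, |x| ≤ 2 * n

namespace IsDescending

variable {n : ℕ} {l m : List ℤ}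

lemma descendsSlowly_centered (h : IsDescending n l) : DescendsSlowly (centered l) := by
  rw [DescendsSlowly, centered, List.isChain_split]
  refine ⟨?_, h.descendsSlowly⟩
  have := h.descendsSlowly.negRev
  rw [negRev_cons] at this
  simpa using this

lemma getLast?_centered (h : IsDescending n l) : ∀ z ∈ (centered l).getLast?, z ≤ 0 := by
  have := h.last_nonpos
  simpa [centered, List.getLast?_append, List.getLast?_cons] using this

lemma lt_of_mem_centered (h : IsDescending n l) :
    ∀ x ∈ centered l, x < 0 + ((2 * n + 1 : ℕ) : ℤ) := by
  intro x hx
  simp only [centered, negRev, List.mem_append, List.mem_reverse, List.mem_map,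
    List.mem_cons] at hx
  push_cast
  rcases hx with ⟨y, hy, rfl⟩ | rfl | hx
  · have := abs_le.1 (h.abs_entry_le y hy)
    omega
  · omega
  · have := abs_le.1 (h.abs_entry_le x hx)
    omega

lemma length_levelWord_centered (h : IsDescending n l) :
    (levelWord (centered l) 0 (2 * n + 1)).length = 2 * n + 1 := by
  rw [length_levelWord _ _ _ h.lt_of_mem_centered]
  have key : (centered l).countP (fun x => (0 : ℤ) + 1 ≤ x) =
      (centered l).countP (fun x => ¬ (0 : ℤ) ≤ x) := by
    conv_lhs => rw [← negRev_centered, negRev, List.countP_reverse, List.countP_map]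
    congr 1
    ext x : 1
    simp only [Function.comp, decide_eq_decide]
    omega
  have h1 := List.length_eq_countP_add_countP (fun x : ℤ => decide (0 ≤ x)) (l := centered l)
  have h2 : (centered l).length = 2 * n + 1 := by
    simp [centered, negRev, h.length_eq]
    omega
  rw [key, ← h2, h1]
  simp

lemma levelWord_centered_eq (h : IsDescending n l) :
    (levelWord (centered l) 0 (2 * n + 1)).dropLast ++ [Step.N] =
      levelWord (centered l) 0 (2 * n + 1) := by
  have h1 : levelWord (centered l) 0 (2 * n + 1) ≠ [] := by
    rw [← List.length_pos_iff, h.length_levelWord_centered]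
    omega
  conv_rhs => rw [← List.dropLast_concat_getLast h1]
  rw [getLast?_levelWord h.descendsSlowly_centered h.getLast?_centered 0 (2 * n + 1) le_rfl
    _ (List.getLast?_eq_getLast_of_ne_nil h1)]

lemma isBallotPath (h : IsDescending n l) :
    IsBallotPath (2 * n) (levelWord (centered l) 0 (2 * n + 1)).dropLast := by
  refine ⟨by simp [h.length_levelWord_centered], fun k => ?_⟩
  rw [List.dropLast_eq_take, List.take_take]
  exact count_take_levelWord _ _ _ h.lt_of_mem_centered _

lemma eq_of_dropLast_eq (hl : IsDescending n l) (hm : IsDescending n m)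
    (h : (levelWord (centered l) 0 (2 * n + 1)).dropLast =
      (levelWord (centered m) 0 (2 * n + 1)).dropLast) : l = m := by
  have hw : levelWord (centered l) 0 (2 * n + 1) = levelWord (centered m) 0 (2 * n + 1) := by
    rw [← hl.levelWord_centered_eq, h, hm.levelWord_centered_eq]
  have hc : (centered l).count 0 = (centered m).count 0 := by
    have h1 := count_levelWord _ _ _ hl.lt_of_mem_centered
    have h2 := count_levelWord _ _ _ hm.lt_of_mem_centered
    rw [hw] at h1
    omega
  have hpos : ∀ j : ℤ, 0 ≤ j → sPlusL j (centered l) = sPlusL j (centered m) := by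
    intro j hj
    by_cases hjn : j < 0 + ((2 * n + 1 : ℕ) : ℤ)
    · exact sPlusL_eq_of_levelWord_eq hl.descendsSlowly_centered hm.descendsSlowly_centered
        hl.getLast?_centered hm.getLast?_centered 0 _ le_rfl hc hw j hj hjn
    · rw [sPlusL_eq_nil fun x hx => (hl.lt_of_mem_centered x hx).trans_le (not_lt.1 hjn),
        sPlusL_eq_nil fun x hx => (hm.lt_of_mem_centered x hx).trans_le (not_lt.1 hjn)]
  have hcc : centered l = centered m := by
    refine eq_of_sPlusL_eq hl.descendsSlowly_centered hm.descendsSlowly_centered fun j => ?_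
    rcases le_or_gt 0 j with hj | hj
    · exact hpos j hj
    · rw [← negRev_centered l, ← negRev_centered m, sPlusL_negRev, sPlusL_negRev,
        hpos _ (by omega)]
  have := (List.append_inj' hcc (by simp [hl.length_eq, hm.length_eq])).2
  exact (List.cons_inj_right 0).1 this

end IsDescending

/-! ### Normalised area vectors -/

/-- The area vector without its last entry. -/
def areaInit (m : ℕ) (π : List Step) : List ℤ :=
  (List.range m).map fun k => (ebn π (k + 1) : ℤ) - ((k + 1 : ℕ) : ℤ)

/-- The nonpositive one of the two candidates for the last entry of the area vector. -/
def normLast (m : ℕ) (π : List Step) : ℤ :=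
  min (2 * (ebn π (m + 1) : ℤ) - ebn π m - m - 1) (2 - (2 * (ebn π (m + 1) : ℤ) - ebn π m - m))

lemma areaBList_eq (m : ℕ) (π : List Step) :
    areaBList (m + 1) π = areaInit m π ++ [areaBv (m + 1) π (m + 1)] := by
  rw [areaBList, List.range_succ, List.map_append, areaInit]
  congr 1
  refine List.map_congr_left fun k hk => ?_
  have := List.mem_range.1 hk
  rw [areaBv, if_neg (by omega), lamB, if_neg (by omega)]

lemma areaBv_last (m : ℕ) (π : List Step) :
    areaBv (m + 1) π (m + 1) = normLast m π ∨ areaBv (m + 1) π (m + 1) = 1 - normLast m π := by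
  simp only [areaBv, lamB, normLast, if_true, Nat.add_sub_cancel]
  push_cast
  split_ifs <;> omega

lemma normLast_nonpos (m : ℕ) (π : List Step) : normLast m π ≤ 0 := by
  rw [normLast]
  omega

lemma le_normLast {m : ℕ} {π : List Step} (h : IsLatticePath (m + 1) (m + 1) π) :
    (ebn π m : ℤ) - m ≤ normLast m π + 1 := by
  have h1 := ebn_le_succ π m
  have h2 := ebn_le_count π (m + 1)
  rw [h.1] at h2
  rw [normLast]
  omega

lemma zetaB_eq_normalised {m : ℕ} {π : List Step} (h : IsLatticePath (m + 1) (m + 1) π) :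
    zetaB (m + 1) π =
      (levelWord (centered (areaInit m π ++ [normLast m π])) 0 (2 * (m + 1) + 1)).dropLast := by
  rw [zetaB_eq_levelWord, ← centered, areaBList_eq]
  have h1 := le_normLast h
  have h2 := normLast_nonpos m π
  rcases areaBv_last m π with h3 | h3
  · rw [h3]
  · rw [h3, dropLast_levelWord_centered _ (by omega) _ (by push_cast; omega), sub_sub_cancel]

lemma isDescending_normalised {m : ℕ} {π : List Step} (h : IsLatticePath (m + 1) (m + 1) π) :
    IsDescending (m + 1) (areaInit m π ++ [normLast m π]) where
  length_eq := by simp [areaInit]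
  descendsSlowly := by
    have h1 : 0 :: areaInit m π = (List.range (m + 1)).map fun k => (ebn π k : ℤ) - k := by
      rw [List.range_succ_eq_map, areaInit]
      simp [ebn, Function.comp_def]
    rw [← List.cons_append, h1, List.range_succ, List.map_append, List.append_assoc]
    refine List.isChain_split.2 ⟨?_, by simpa using le_normLast h⟩
    rw [← List.map_singleton (f := fun k : ℕ => (ebn π k : ℤ) - k), ← List.map_append,
      ← List.range_succ, List.isChain_map, List.isChain_range_succ]
    intro k _
    have := ebn_le_succ π k
    rw [Nat.succ_eq_add_one]
    push_cast
    omega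
  last_nonpos := by
    rw [← List.cons_append, List.getLast?_concat]
    simpa using normLast_nonpos m π
  abs_entry_le := by
    intro x hx
    rw [abs_le]
    push_cast
    rcases List.mem_append.1 hx with hx | hx
    · obtain ⟨k, hk, rfl⟩ := List.mem_map.1 hx
      have h1 := List.mem_range.1 hk
      have h2 := ebn_le_count π (k + 1)
      rw [h.1] at h2
      push_cast
      omega
    · obtain rfl := List.mem_singleton.1 hx
      have h1 := le_normLast h
      have h2 := normLast_nonpos m π
      omega

lemma eq_of_normalised_eq {m : ℕ} {π ρ : List Step} (hπ : IsLatticePath (m + 1) (m + 1) π)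
    (hρ : IsLatticePath (m + 1) (m + 1) ρ)
    (h : areaInit m π ++ [normLast m π] = areaInit m ρ ++ [normLast m ρ]) : π = ρ := by
  obtain ⟨h1, h2⟩ := List.append_inj' h rfl
  have h3 : ∀ k < m, ebn π (k + 1) = ebn ρ (k + 1) := by
    intro k hk
    have := List.map_inj_left.1 h1 k (List.mem_range.2 hk)
    omega
  have h4 : ebn π m = ebn ρ m := by
    rcases m with _ | m
    · simp [ebn]
    · exact h3 m (by omega)
  have h5 : normLast m π = normLast m ρ := by simpa using h2
  refine eq_of_ebn_eq π ρ (hπ.1.trans hρ.1.symm) (hπ.2.trans hρ.2.symm) fun k hk => ?_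
  rw [hπ.2] at hk
  rcases eq_or_lt_of_le (Nat.le_of_lt_succ hk) with rfl | hk
  · rw [normLast, normLast, h4] at h5
    omega
  · exact h3 k hk

/-- For every `n ≥ 2`, the type `Bₙ` zeta map is a bijection from
lattice paths in `L_{n,n}` onto ballot paths of length `2n`. -/
theorem zetaB_bijOn (n : ℕ) (hn : 2 ≤ n) :
    Set.BijOn (zetaB n) {π : List Step | IsLatticePath n n π}
      {β : List Step | IsBallotPath (2 * n) β} := by
  obtain ⟨m, rfl⟩ : ∃ m, n = m + 1 := ⟨n - 1, by omega⟩
  have hmaps : Set.MapsTo (zetaB (m + 1)) {π : List Step | IsLatticePath (m + 1) (m + 1) π}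
      {β : List Step | IsBallotPath (2 * (m + 1)) β} := fun π hπ => by
    rw [Set.mem_ofPred_eq, zetaB_eq_normalised hπ]
    exact (isDescending_normalised hπ).isBallotPath
  have hinj : Set.InjOn (zetaB (m + 1)) {π : List Step | IsLatticePath (m + 1) (m + 1) π} :=
    fun π hπ ρ hρ h => by
      rw [zetaB_eq_normalised hπ, zetaB_eq_normalised hρ] at h
      exact eq_of_normalised_eq hπ hρ
        ((isDescending_normalised hπ).eq_of_dropLast_eq (isDescending_normalised hρ) h)
  have hfin : {β : List Step | IsBallotPath (2 * (m + 1)) β}.Finite :=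
    (stepWords (2 * (m + 1))).finite_toSet.subset fun β hβ => mem_stepWords.2 hβ.1
  refine ⟨hmaps, hinj, ?_⟩
  rw [Set.SurjOn, Set.eq_of_subset_of_ncard_le hmaps.image_subset ?_ hfin]
  rw [hinj.ncard_image, ncard_ballot_eq]
end
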